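/- arXiv:1910.10984 — 2 statements merged into one kernel-verified Lean document; each statement's English description precedes it below -/
import Mathlib

section
/- For every natural number n ≥ 2, 3(n−1) + 1 ≤ D(C_n³) ≤ min{20369, 3^{ω(n)}}·(n−1) + 1, where ω(n) is the number of distinct prime factors of n. -/
/-- The `m`-th Davenport constant: smallest `t` such that every sequence (multiset) over `G`
of length `≥ t` contains `m` disjoint non-empty zero-sum subsequences. -/
noncomputable def DavenportM (G : Type*) [AddCommGroup G] (m : ℕ) : ℕ :=
  sInf {t | ∀ S : Multiset G, t ≤ Multiset.card S →
    ∃ L : Multiset (Multiset G), Multiset.card L = m ∧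
      (∀ T ∈ L, T ≠ 0 ∧ T.sum = 0) ∧ L.sum ≤ S}

/-- The Davenport constant: smallest `t` such that every sequence over `G` of length `≥ t`
has a non-empty zero-sum subsequence. -/
noncomputable def Davenport (G : Type*) [AddCommGroup G] : ℕ :=
  sInf {t | ∀ S : Multiset G, t ≤ Multiset.card S → ∃ T ≤ S, T ≠ 0 ∧ T.sum = 0}

/-- `η(G)`: smallest `t` such that every sequence over `G` of length `≥ t` has a non-empty
zero-sum subsequence of length at most `exp G`. -/
noncomputable def etaC (G : Type*) [AddCommGroup G] : ℕ :=
  sInf {t | ∀ S : Multiset G, t ≤ Multiset.card S →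
    ∃ T ≤ S, T ≠ 0 ∧ T.sum = 0 ∧ Multiset.card T ≤ AddMonoid.exponent G}

/-- The Erdős–Ginzburg–Ziv constant `s(G)`: smallest `t` such that every sequence over `G` of
length `≥ t` has a zero-sum subsequence of length exactly `exp G`. -/
noncomputable def egz (G : Type*) [AddCommGroup G] : ℕ :=
  sInf {t | ∀ S : Multiset G, t ≤ Multiset.card S →
    ∃ T ≤ S, T.sum = 0 ∧ Multiset.card T = AddMonoid.exponent G}

/-- If `I ^ m = 0` and `J ^ n = 0`, then `(I ⊔ J) ^ (m + n - 1) = 0`. -/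
theorem ideal_sup_pow_eq_bot {R : Type*} [CommRing R] {I J : Ideal R} {m n : ℕ}
    (hI : I ^ (m + 1) = ⊥) (hJ : J ^ (n + 1) = ⊥) : (I ⊔ J) ^ (m + n + 1) = ⊥ := by
  rw [← Ideal.add_eq_sup, add_pow, ← Ideal.zero_eq_bot]
  refine Finset.sum_eq_zero fun k _ => ?_
  rcases le_or_gt (m + 1) k with hk | hk
  · have : I ^ k = 0 := le_bot_iff.1 (hI ▸ Ideal.pow_le_pow_right hk)
    rw [this, zero_mul, zero_mul]
  · have : J ^ (m + n + 1 - k) = 0 :=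
      le_bot_iff.1 (hJ ▸ Ideal.pow_le_pow_right (by omega))
    rw [this, mul_zero, zero_mul]

/-- An ideal generated by `d` elements with vanishing `(m + 1)`-st power has vanishing
`(d * m + 1)`-st power. -/
theorem ideal_span_pow_eq_bot {R κ : Type*} [CommRing R] {m : ℕ} (x : κ → R)
    (hx : ∀ j, x j ^ (m + 1) = 0) (s : Finset κ) :
    Ideal.span (x '' s) ^ (s.card * m + 1) = ⊥ := by
  classical
  induction s using Finset.induction_on with
  | empty => simp
  | insert j s hj ih =>
    rw [Finset.coe_insert, Set.image_insert_eq, Ideal.span_insert, Finset.card_insert_of_notMem hj,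
      show (s.card + 1) * m + 1 = m + s.card * m + 1 by ring]
    refine ideal_sup_pow_eq_bot ?_ ih
    rw [Ideal.span_singleton_pow, hx, Ideal.span_singleton_eq_bot]

/-- In `𝔽_p[C_{p^k}³]` a product of `3 (p ^ k - 1) + 1` factors `1 - X^g` vanishes (Olson). -/
theorem prod_one_sub_single_eq_zero {ι : Type*} {p k q : ℕ} [Fact p.Prime] (hq : q = p ^ k)
    (s : Finset ι)
    (g : ι → Fin 3 → ZMod q) (hs : 3 * (q - 1) + 1 ≤ s.card) :
    ∏ i ∈ s, (1 - AddMonoidAlgebra.single (g i) (1 : ZMod p)) = 0 := by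
  classical
  subst hq
  have hq : p ^ k - 1 + 1 = p ^ k := Nat.sub_add_cancel (Nat.pos_of_ne_zero
    (pow_ne_zero k (Fact.out : p.Prime).ne_zero))
  have : NeZero (p ^ k) := ⟨by omega⟩
  set R := AddMonoidAlgebra (ZMod p) (Fin 3 → ZMod (p ^ k))
  have : CharP R p := charP_of_injective_algebraMap
    (FaithfulSMul.algebraMap_injective (ZMod p) R) p
  let x : Fin 3 → R := fun j => 1 - AddMonoidAlgebra.single (Pi.single j 1) 1
  set I : Ideal R := Ideal.span (x '' (Finset.univ : Finset (Fin 3))) with hI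
  have hIpow : I ^ (3 * (p ^ k - 1) + 1) = ⊥ := by
    refine ideal_span_pow_eq_bot x (fun j => ?_) Finset.univ
    rw [hq, sub_pow_char_pow, one_pow, AddMonoidAlgebra.single_pow, one_pow,
      ← Pi.single_smul]
    have h0 : p ^ k • (1 : ZMod (p ^ k)) = 0 := by simp
    rw [h0, Pi.single_zero, AddMonoidAlgebra.one_def, sub_self]
  let H : AddSubmonoid (Fin 3 → ZMod (p ^ k)) :=
    { carrier := {v | (1 - AddMonoidAlgebra.single v 1 : R) ∈ I}
      zero_mem' := by simp [AddMonoidAlgebra.one_def]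
      add_mem' := by
        intro v w hv hw
        have : (1 - AddMonoidAlgebra.single (v + w) 1 : R) =
            (1 - AddMonoidAlgebra.single v 1) +
              AddMonoidAlgebra.single v 1 * (1 - AddMonoidAlgebra.single w 1) := by
          rw [mul_sub, AddMonoidAlgebra.single_mul_single]; simp
        simp only [Set.mem_ofPred_eq] at hv hw ⊢
        rw [this]
        exact I.add_mem hv (I.mul_mem_left _ hw) }
  have hmem : ∀ v, v ∈ H := by
    intro v
    have hv : v = ∑ j, (v j).val • Pi.single j (1 : ZMod (p ^ k)) := by
      ext j
      simp only [Finset.sum_apply, Pi.smul_apply]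
      simp [Pi.single_apply]
    rw [hv]
    refine H.sum_mem fun j _ => H.nsmul_mem (Ideal.subset_span ⟨j, by simp, rfl⟩) _
  have hprod : ∏ i ∈ s, (1 - AddMonoidAlgebra.single (g i) 1 : R) ∈ I ^ s.card := by
    rw [← Finset.prod_const]
    exact Ideal.prod_mem_prod fun i _ => hmem (g i)
  have := Ideal.pow_le_pow_right hs hprod
  rwa [hIpow, Ideal.mem_bot] at this

/-- Olson's identity: among the subsequences with a given sum of a long sequence over `C_{p^k}³`,
those of even and of odd length are equinumerous modulo `p`. -/
theorem sum_neg_one_pow_card_eq_zero {ι : Type*} {p k q : ℕ} [Fact p.Prime] (hq : q = p ^ k)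
    (s : Finset ι)
    (g : ι → Fin 3 → ZMod q) (hs : 3 * (q - 1) + 1 ≤ s.card) (h : Fin 3 → ZMod q) :
    ∑ J ∈ s.powerset with ∑ i ∈ J, g i = h, (-1 : ZMod p) ^ J.card = 0 := by
  classical
  have h0 := prod_one_sub_single_eq_zero hq s g hs
  simp only [sub_eq_add_neg] at h0
  rw [Finset.prod_one_add] at h0
  have h1 : ∀ J : Finset ι, ∏ i ∈ J, -(AddMonoidAlgebra.single (g i) (1 : ZMod p)) =
      AddMonoidAlgebra.single (∑ i ∈ J, g i) ((-1 : ZMod p) ^ J.card) := by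
    intro J
    induction J using Finset.induction_on with
    | empty => simp [AddMonoidAlgebra.one_def]
    | insert i J hi ih =>
      rw [Finset.prod_insert hi, ih, Finset.sum_insert hi, Finset.card_insert_of_notMem hi,
        ← AddMonoidAlgebra.single_neg, AddMonoidAlgebra.single_mul_single, pow_succ']
  simp only [h1] at h0
  have h2 := congrArg (fun f : AddMonoidAlgebra (ZMod p) (Fin 3 → ZMod q) => f.coeff h) h0
  simpa [Finset.sum_filter, AddMonoidAlgebra.coeff_sum, Finsupp.finsetSum_apply,
    Finsupp.single_apply] using h2

/-- `D(C_{p^k}³) ≤ 3 (p ^ k - 1) + 1`. -/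
theorem exists_zero_sum_of_primePow {ι : Type*} {p k q : ℕ} [Fact p.Prime] (hq : q = p ^ k)
    (s : Finset ι)
    (g : ι → Fin 3 → ZMod q) (hs : 3 * (q - 1) + 1 ≤ s.card) :
    ∃ J ⊆ s, J.Nonempty ∧ ∑ i ∈ J, g i = 0 := by
  classical
  by_contra! hcon
  have h0 := sum_neg_one_pow_card_eq_zero hq s g hs 0
  have : s.powerset.filter (fun J => ∑ i ∈ J, g i = 0) = {∅} := by
    ext J
    simp only [Finset.mem_filter, Finset.mem_powerset, Finset.mem_singleton]
    refine ⟨fun hJ => ?_, fun hJ => by simp [hJ]⟩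
    by_contra hne
    exact hcon J hJ.1 (Finset.nonempty_iff_ne_empty.2 hne) hJ.2
  rw [this] at h0
  simp at h0

/-- If one coordinate of all terms is `1`, the length of a zero-sum sequence is divisible by `p`. -/
theorem dvd_card_of_sum_eq_zero {ι : Type*} {p : ℕ} {J : Finset ι} {g : ι → Fin 3 → ZMod p}
    {j : Fin 3} (hg : ∀ i ∈ J, g i j = 1) (hJ : ∑ i ∈ J, g i = 0) : p ∣ J.card := by
  have h := congrFun hJ j
  rw [Finset.sum_apply, Finset.sum_congr rfl hg] at h
  simpa [ZMod.natCast_eq_zero_iff] using h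

theorem exists_zero_sum_card_eq_of_card_eq_three_mul {ι : Type*} {p : ℕ} [Fact p.Prime]
    {s : Finset ι} {g : ι → Fin 3 → ZMod p} {j : Fin 3} (hg : ∀ i ∈ s, g i j = 1)
    (hs : s.card = 3 * p) (hs0 : ∑ i ∈ s, g i = 0) :
    ∃ J ⊆ s, J.card = p ∧ ∑ i ∈ J, g i = 0 := by
  classical
  have hp := (Fact.out : p.Prime).two_le
  obtain ⟨i, hi⟩ : s.Nonempty := Finset.card_pos.1 (by omega)
  have hcard := Finset.card_erase_of_mem hi
  obtain ⟨J, hJs, hJ, hJ0⟩ := exists_zero_sum_of_primePow (pow_one p).symm (s.erase i) g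
    (by omega)
  have hJs' := hJs.trans (Finset.erase_subset i s)
  have hle := Finset.card_le_card hJs
  have hpos := hJ.card_pos
  obtain ⟨c, hc⟩ := dvd_card_of_sum_eq_zero (fun i hi => hg i (hJs' hi)) hJ0
  have hc3 : c < 3 := by
    by_contra! h
    have := Nat.mul_le_mul_left p h
    omega
  interval_cases c
  · omega
  · exact ⟨J, hJs', by omega, hJ0⟩
  · refine ⟨s \ J, Finset.sdiff_subset, ?_, ?_⟩
    · rw [Finset.card_sdiff_of_subset hJs']; omega
    · rw [← Finset.sum_sdiff hJs', hJ0, add_zero] at hs0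
      exact hs0

/-- Rónyai's bound `s(C_p²) ≤ 4 p - 2`, with the two-dimensional group embedded in `C_p³` as the
affine plane on which one coordinate is `1`. -/
theorem exists_zero_sum_card_eq_prime {ι : Type*} {p : ℕ} [Fact p.Prime] (hp2 : p ≠ 2)
    {s : Finset ι} {g : ι → Fin 3 → ZMod p} {j : Fin 3} (hg : ∀ i ∈ s, g i j = 1)
    (hs : 4 * p - 2 ≤ s.card) :
    ∃ J ⊆ s, J.card = p ∧ ∑ i ∈ J, g i = 0 := by
  classical
  have hp := (Fact.out : p.Prime).two_le
  obtain ⟨s', hs's, hs'⟩ := Finset.exists_subset_card_eq hs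
  by_contra! hcon
  replace hcon : ∀ J ⊆ s', J.card = p → ∑ i ∈ J, g i ≠ 0 := fun J hJ => hcon J (hJ.trans hs's)
  replace hg : ∀ i ∈ s', g i j = 1 := fun i hi => hg i (hs's hi)
  have hcard : ∀ K ⊆ s', K.Nonempty → ∑ i ∈ K, g i = 0 → K.card = 2 * p := by
    intro K hK hKn hK0
    obtain ⟨c, hc⟩ := dvd_card_of_sum_eq_zero (fun i hi => hg i (hK hi)) hK0
    have hle := Finset.card_le_card hK
    have hpos := hKn.card_pos
    have hc4 : c < 4 := by
      by_contra! h
      have := Nat.mul_le_mul_left p h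
      omega
    interval_cases c
    · omega
    · exact absurd hK0 (hcon K hK (by omega))
    · omega
    · obtain ⟨J, hJ, hJp, hJ0⟩ := exists_zero_sum_card_eq_of_card_eq_three_mul
        (fun i hi => hg i (hK hi)) (by omega) hK0
      exact absurd hJ0 (hcon J (hJ.trans hK) hJp)
  set T := (s'.powersetCard (2 * p)).filter (fun K => ∑ i ∈ K, g i = 0) with hT
  have h1 : (1 : ZMod p) + T.card = 0 := by
    have h := sum_neg_one_pow_card_eq_zero (pow_one p).symm s' g (by omega) 0
    have hZ : s'.powerset.filter (fun K => ∑ i ∈ K, g i = 0) = insert ∅ T := by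
      ext K
      simp only [hT, Finset.mem_filter, Finset.mem_powerset, Finset.mem_insert,
        Finset.mem_powersetCard]
      constructor
      · rintro ⟨hK, hK0⟩
        rcases K.eq_empty_or_nonempty with h | h
        · exact Or.inl h
        · exact Or.inr ⟨⟨hK, hcard K hK h hK0⟩, hK0⟩
      · rintro (rfl | h)
        · simp
        · exact ⟨h.1.1, h.2⟩
    have hT0 : ∅ ∉ T := by
      simp only [hT, Finset.mem_filter, Finset.mem_powersetCard, Finset.card_empty]
      omega
    rw [hZ, Finset.sum_insert hT0, Finset.sum_congr rfl (g := fun _ => (1 : ZMod p))] at h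
    · simpa using h
    · intro K hK
      rw [(Finset.mem_powersetCard.1 (Finset.mem_filter.1 hK).1).2, pow_mul]
      simp
  have h2 : ∀ I ∈ s'.powersetCard p, ((T.filter (fun K => I ⊆ K)).card : ZMod p) = 0 := by
    intro I hI
    obtain ⟨hIs, hIp⟩ := Finset.mem_powersetCard.1 hI
    have hsdiff := Finset.card_sdiff_of_subset hIs
    have h := sum_neg_one_pow_card_eq_zero (pow_one p).symm (s' \ I) g (by omega)
      (-∑ i ∈ I, g i)
    have hJ : ∀ J ⊆ s' \ I, ∑ i ∈ J, g i = -∑ i ∈ I, g i →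
        I ∪ J ⊆ s' ∧ Disjoint I J ∧ J.card = p ∧ ∑ i ∈ I ∪ J, g i = 0 := by
      intro J hJ hJ0
      have hdisj : Disjoint I J := (Finset.disjoint_of_subset_left hJ Finset.sdiff_disjoint).symm
      have hsub : I ∪ J ⊆ s' := Finset.union_subset hIs (hJ.trans Finset.sdiff_subset)
      have hsum : ∑ i ∈ I ∪ J, g i = 0 := by
        rw [Finset.sum_union hdisj, hJ0, add_neg_cancel]
      have hc := hcard _ hsub ((Finset.card_pos.1 (by omega : 0 < I.card)).mono
        Finset.subset_union_left) hsum
      rw [Finset.card_union_of_disjoint hdisj] at hc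
      exact ⟨hsub, hdisj, by omega, hsum⟩
    rw [Finset.sum_congr rfl (g := fun _ => (-1 : ZMod p) ^ p)] at h
    · rw [Finset.sum_const, nsmul_eq_mul] at h
      have hbij : ((s' \ I).powerset.filter (fun J => ∑ i ∈ J, g i = -∑ i ∈ I, g i)).card =
          (T.filter (fun K => I ⊆ K)).card := by
        refine Finset.card_nbij' (fun J => I ∪ J) (fun K => K \ I) ?_ ?_ ?_ ?_
        · intro J hJm
          simp only [Finset.coe_filter, Finset.mem_powerset, Set.mem_ofPred_eq] at hJm
          obtain ⟨ha, hb, hc, hd⟩ := hJ J hJm.1 hJm.2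
          simp only [hT, Finset.coe_filter, Finset.mem_filter, Finset.mem_powersetCard,
            Set.mem_ofPred_eq]
          refine ⟨⟨⟨ha, ?_⟩, hd⟩, Finset.subset_union_left⟩
          rw [Finset.card_union_of_disjoint hb]
          omega
        · intro K hK
          simp only [hT, Finset.coe_filter, Finset.mem_filter, Finset.mem_powersetCard,
            Set.mem_ofPred_eq] at hK
          simp only [Finset.coe_filter, Finset.mem_powerset, Set.mem_ofPred_eq]
          refine ⟨Finset.sdiff_subset_sdiff hK.1.1.1 le_rfl, ?_⟩
          rw [eq_neg_iff_add_eq_zero, Finset.sum_sdiff hK.2, hK.1.2]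
        · intro J hJm
          simp only [Finset.coe_filter, Finset.mem_powerset, Set.mem_ofPred_eq] at hJm
          exact Finset.union_sdiff_cancel_left (hJ J hJm.1 hJm.2).2.1
        · intro K hK
          simp only [Finset.coe_filter, Set.mem_ofPred_eq] at hK
          exact Finset.union_sdiff_of_subset hK.2
      rw [hbij] at h
      exact (mul_eq_zero.1 h).resolve_right (pow_ne_zero _ (neg_ne_zero.2 one_ne_zero))
    · intro J hJm
      obtain ⟨hJs, hJ0⟩ := Finset.mem_filter.1 hJm
      rw [(hJ J (Finset.mem_powerset.1 hJs) hJ0).2.2.1]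
  have h3 : ((T.card * (2 * p).choose p : ℕ) : ZMod p) = 0 := by
    have hdc := Finset.sum_card_bipartiteAbove_eq_sum_card_bipartiteBelow
      (s := s'.powersetCard p) (t := T) (fun I K => I ⊆ K)
    have hK : ∀ K ∈ T, ((s'.powersetCard p).bipartiteBelow (fun I K => I ⊆ K) K).card =
        (2 * p).choose p := by
      intro K hK
      obtain ⟨hKs, hKc⟩ := Finset.mem_powersetCard.1 (Finset.mem_filter.1 hK).1
      rw [← hKc, ← Finset.card_powersetCard]
      congr 1
      ext I
      simp only [Finset.mem_bipartiteBelow, Finset.mem_powersetCard]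
      exact ⟨fun h => ⟨h.2, h.1.2⟩, fun h => ⟨⟨h.1.trans hKs, h.2⟩, h.1⟩⟩
    rw [Finset.sum_congr rfl hK, Finset.sum_const, smul_eq_mul] at hdc
    rw [← hdc, Nat.cast_sum]
    exact Finset.sum_eq_zero h2
  have hchoose : (((2 * p).choose p : ℕ) : ZMod p) = 2 := by
    have h := Choose.choose_modEq_choose_mod_mul_choose_div_nat (n := 2 * p) (k := p) (p := p)
    rw [Nat.mul_mod_left, Nat.mod_self, Nat.mul_div_cancel _ (by omega : 0 < p),
      Nat.div_self (by omega), Nat.choose_self, Nat.choose_one_right, one_mul] at h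
    exact_mod_cast (ZMod.natCast_eq_natCast_iff _ _ _).2 h
  have h2ne : (2 : ZMod p) ≠ 0 := by
    intro h
    have : p ∣ 2 := (ZMod.natCast_eq_zero_iff 2 p).1 (by exact_mod_cast h)
    exact hp2 ((Nat.prime_dvd_prime_iff_eq Fact.out Nat.prime_two).1 this)
  rw [Nat.cast_mul, hchoose] at h3
  rw [(mul_eq_zero.1 h3).resolve_right h2ne, add_zero] at h1
  exact one_ne_zero h1

/-- At least `4 p - 2` vectors on an affine plane of `𝔽_p³` contain `p` vectors with sum `0`. -/
theorem exists_zero_sum_of_affine_plane {ι : Type*} {p : ℕ} [Fact p.Prime] (hp2 : p ≠ 2)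
    {s : Finset ι} {a : ι → Fin 3 → ZMod p} {u : Fin 3 → ZMod p} (hu : u ≠ 0) {c : ZMod p}
    (hc : ∀ i ∈ s, u ⬝ᵥ a i = c) (hs : 4 * p - 2 ≤ s.card) :
    ∃ J ⊆ s, J.card = p ∧ ∑ i ∈ J, a i = 0 := by
  classical
  obtain ⟨j, hj⟩ := Function.ne_iff.1 hu
  obtain ⟨J, hJs, hJp, hJ⟩ := exists_zero_sum_card_eq_prime hp2
    (g := fun i => Function.update (a i) j 1) (j := j) (by simp) hs
  refine ⟨J, hJs, hJp, ?_⟩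
  have hne : ∀ l ≠ j, (∑ i ∈ J, a i) l = 0 := by
    intro l hl
    have := congrFun hJ l
    simpa [Finset.sum_apply, Function.update_of_ne hl] using this
  have hdot : u ⬝ᵥ ∑ i ∈ J, a i = 0 := by
    rw [dotProduct_sum, Finset.sum_congr rfl fun i hi => hc i (hJs hi)]
    simp [hJp]
  have hsingle : u ⬝ᵥ ∑ i ∈ J, a i = u j * (∑ i ∈ J, a i) j :=
    Finset.sum_eq_single j (fun l _ hl => by rw [hne l hl, mul_zero]) (by simp)
  rw [hsingle] at hdot
  ext l
  by_cases hl : l = j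
  · exact hl ▸ (mul_eq_zero.1 hdot).resolve_left hj
  · exact hne l hl

/-- Every element of `Y` is the sum of at most `r` terms of the sequence `a` with indices in `B`. -/
def SubsumsIn {ι M : Type*} [AddCommMonoid M] (a : ι → M) (B : Finset ι) (r : ℕ) (Y : Finset M) :
    Prop :=
  ∀ y ∈ Y, ∃ J ⊆ B, J.card ≤ r ∧ ∑ i ∈ J, a i = y

theorem SubsumsIn.mono {ι M : Type*} [AddCommMonoid M] {a : ι → M} {B B' : Finset ι} {r r' : ℕ}
    {Y : Finset M} (h : SubsumsIn a B r Y) (hB : B ⊆ B') (hr : r ≤ r') : SubsumsIn a B' r' Y := by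
  intro y hy
  obtain ⟨J, hJ, hJr, rfl⟩ := h y hy
  exact ⟨J, hJ.trans hB, hJr.trans hr, rfl⟩

theorem SubsumsIn.image_add {ι M : Type*} [AddCommMonoid M] [DecidableEq ι] [DecidableEq M]
    {a : ι → M} {B : Finset ι} {r : ℕ} {Y : Finset M} (h : SubsumsIn a B r Y) {i : ι}
    (hi : i ∉ B) : SubsumsIn a (insert i B) (r + 1) (Y.image (· + a i)) := by
  intro y hy
  obtain ⟨x, hx, rfl⟩ := Finset.mem_image.1 hy
  obtain ⟨J, hJ, hJr, rfl⟩ := h x hx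
  have hiJ : i ∉ J := fun h => hi (hJ h)
  refine ⟨insert i J, Finset.insert_subset_insert _ hJ, ?_, ?_⟩
  · rw [Finset.card_insert_of_notMem hiJ]; omega
  · rw [Finset.sum_insert hiJ, add_comm]

theorem SubsumsIn.union {ι M : Type*} [AddCommMonoid M] [DecidableEq M]
    {a : ι → M} {B : Finset ι} {r : ℕ} {Y Z : Finset M} (hY : SubsumsIn a B r Y)
    (hZ : SubsumsIn a B r Z) : SubsumsIn a B r (Y ∪ Z) := fun y hy =>
  (Finset.mem_union.1 hy).elim (hY y) (hZ y)

/-- The forward difference in direction `h`, as a linear map on functions. -/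
def diffMap {R V : Type*} [CommRing R] [AddCommGroup V] (h : V) : (V → R) →ₗ[R] (V → R) where
  toFun f x := f (x + h) - f x
  map_add' f g := by ext x; simp only [Pi.add_apply]; ring
  map_smul' c f := by ext x; simp only [Pi.smul_apply, smul_eq_mul, RingHom.id_apply]; ring

/-- The functions all of whose `k`-fold differences vanish: polynomial functions of degree less
than `k`. -/
def degLT (R V : Type*) [CommRing R] [AddCommGroup V] : ℕ → Submodule R (V → R)
  | 0 => ⊥
  | k + 1 => ⨅ h : V, (degLT R V k).comap (diffMap h)

theorem mem_degLT_succ {R V : Type*} [CommRing R] [AddCommGroup V] {k : ℕ} {f : V → R} :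
    f ∈ degLT R V (k + 1) ↔ ∀ h, diffMap h f ∈ degLT R V k := by
  simp [degLT, Submodule.mem_iInf]

theorem degLT_le_succ {R V : Type*} [CommRing R] [AddCommGroup V] (k : ℕ) :
    degLT R V k ≤ degLT R V (k + 1) := by
  induction k with
  | zero => exact bot_le
  | succ k ih => exact fun f hf => mem_degLT_succ.2 fun h => ih (mem_degLT_succ.1 hf h)

theorem mul_mem_degLT {R V : Type*} [CommRing R] [AddCommGroup V] {k : ℕ} {f : V → R}
    (hf : f ∈ degLT R V k) (l : V →+ R) (c : R) :
    (fun x => (l x - c) * f x) ∈ degLT R V (k + 1) := by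
  induction k generalizing f with
  | zero =>
    have : f = 0 := hf
    simp only [this, Pi.zero_apply, mul_zero]
    exact Submodule.zero_mem _
  | succ k ih =>
    refine mem_degLT_succ.2 fun h => ?_
    have hd := mem_degLT_succ.1 hf h
    have heq : diffMap h (fun x => (l x - c) * f x) =
        (fun x => (l x - c) * diffMap h f x) + l h • (f + diffMap h f) := by
      ext x
      simp only [diffMap, LinearMap.coe_mk, AddHom.coe_mk, Pi.add_apply, Pi.smul_apply,
        smul_eq_mul, map_add]
      ring
    rw [heq]
    exact Submodule.add_mem _ (ih hd)
      (Submodule.smul_mem _ _ (Submodule.add_mem _ hf (degLT_le_succ k hd)))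

theorem prod_mem_degLT {R V κ : Type*} [CommRing R] [AddCommGroup V] (T : Finset κ)
    (l : κ → V →+ R) (c : κ → R) :
    (fun x => ∏ t ∈ T, (l t x - c t)) ∈ degLT R V (T.card + 1) := by
  classical
  induction T using Finset.induction_on with
  | empty =>
    refine mem_degLT_succ.2 fun h => ?_
    have : diffMap h (fun x : V => ∏ t ∈ (∅ : Finset κ), (l t x - c t)) = 0 := by
      ext x; simp [diffMap]
    rw [this]
    exact Submodule.zero_mem _
  | insert t T ht ih =>
    simp only [Finset.prod_insert ht, Finset.card_insert_of_notMem ht]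
    exact mul_mem_degLT ih (l t) (c t)

/-- A set on which no nonzero polynomial function of degree at most `3 m` vanishes has at least
`(m + 1) ^ 3` elements. -/
theorem pow_le_card_of_degLT {p m : ℕ} [Fact p.Prime] (hm : m < p)
    {Y : Finset (Fin 3 → ZMod p)}
    (hY : ∀ f ∈ degLT (ZMod p) (Fin 3 → ZMod p) (3 * m + 1), (∀ y ∈ Y, f y = 0) → f = 0) :
    (m + 1) ^ 3 ≤ Y.card := by
  classical
  let T : (Fin 3 → Fin (m + 1)) → Finset (Fin 3 × Fin (m + 1)) := fun c =>
    Finset.univ.filter fun t => t.2 ≠ c t.1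
  let F : (Fin 3 → Fin (m + 1)) → (Fin 3 → ZMod p) → ZMod p := fun c x =>
    ∏ t ∈ T c, (x t.1 - (t.2 : ℕ))
  let pt : (Fin 3 → Fin (m + 1)) → Fin 3 → ZMod p := fun c j => ((c j : ℕ) : ZMod p)
  have hcast : ∀ i j : Fin (m + 1), ((i : ℕ) : ZMod p) = ((j : ℕ) : ZMod p) → i = j := by
    intro i j h
    rw [ZMod.natCast_eq_natCast_iff', Nat.mod_eq_of_lt (by omega), Nat.mod_eq_of_lt (by omega)] at h
    exact Fin.ext h
  have hTcard : ∀ c, (T c).card = 3 * m := by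
    intro c
    have h1 : (T c).card + (Finset.univ.filter fun t : Fin 3 × Fin (m + 1) => t.2 = c t.1).card =
        3 * (m + 1) := by
      rw [add_comm, Finset.card_filter_add_card_filter_not]
      simp
    have h2 : (Finset.univ.filter fun t : Fin 3 × Fin (m + 1) => t.2 = c t.1).card = 3 := by
      have : (Finset.univ.filter fun t : Fin 3 × Fin (m + 1) => t.2 = c t.1) =
          Finset.univ.image fun j => (j, c j) := by
        ext ⟨j, i⟩
        simp [eq_comm]
      rw [this, Finset.card_image_of_injective _ fun i j h => (Prod.ext_iff.1 h).1]
      simp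
    omega
  have hFmem : ∀ c, F c ∈ degLT (ZMod p) (Fin 3 → ZMod p) (3 * m + 1) := by
    intro c
    have := prod_mem_degLT (V := Fin 3 → ZMod p) (T c) (fun t => Pi.evalAddMonoidHom _ t.1)
      (fun t => ((t.2 : ℕ) : ZMod p))
    rwa [hTcard] at this
  have hFself : ∀ c, F c (pt c) ≠ 0 := by
    intro c
    refine Finset.prod_ne_zero_iff.2 fun t ht => sub_ne_zero.2 fun h => ?_
    exact (Finset.mem_filter.1 ht).2 (hcast _ _ h).symm
  have hFne : ∀ c c', c ≠ c' → F c (pt c') = 0 := by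
    intro c c' h
    obtain ⟨j, hj⟩ := Function.ne_iff.1 h
    exact Finset.prod_eq_zero (i := (j, c' j))
      (Finset.mem_filter.2 ⟨Finset.mem_univ _, Ne.symm hj⟩) (sub_self _)
  have hli : LinearIndependent (ZMod p) fun (c : Fin 3 → Fin (m + 1)) (y : Y) => F c y := by
    refine Fintype.linearIndependent_iff.2 fun g hg c => ?_
    have hzero : ∑ c, g c • F c = 0 := by
      refine hY _ (Submodule.sum_mem _ fun c _ => Submodule.smul_mem _ _ (hFmem c)) fun y hy => ?_
      have := congrFun hg ⟨y, hy⟩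
      simpa [Finset.sum_apply] using this
    have h := congrFun hzero (pt c)
    rw [Finset.sum_apply, Finset.sum_eq_single c] at h
    · simpa [hFself c] using h
    · intro c' _ hc'
      rw [Pi.smul_apply, hFne c' c hc', smul_zero]
    · simp
  have h := hli.fintype_card_le_finrank
  simpa using h

/-- A set of indices whose terms lie on no common plane through `0` contains a basis. -/
theorem exists_spanning_subset {ι : Type*} {p : ℕ} [Fact p.Prime] {A : Finset ι}
    {a : ι → Fin 3 → ZMod p} (hA : ∀ u ≠ 0, ∃ i ∈ A, u ⬝ᵥ a i ≠ 0) :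
    ∃ I ⊆ A, I.card ≤ 3 ∧ Submodule.span (ZMod p) (a '' I) = ⊤ := by
  classical
  have htop : Submodule.span (ZMod p) (a '' A) = ⊤ := by
    by_contra hne
    obtain ⟨f, hf, hker⟩ := Submodule.exists_le_ker_of_lt_top _ (lt_top_iff_ne_top.2 hne)
    have hfu : ∀ v, f v = (fun j => f (Pi.single j 1)) ⬝ᵥ v := by
      intro v
      rw [LinearMap.pi_apply_eq_sum_univ f v]
      simp only [dotProduct, smul_eq_mul]
      refine Finset.sum_congr rfl fun j _ => ?_
      rw [mul_comm]
      congr 2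
      ext l
      simp [Pi.single_apply, eq_comm]
    obtain ⟨i, hi, hne⟩ := hA (fun j => f (Pi.single j 1)) (by
      intro h0
      refine hf (LinearMap.ext fun v => ?_)
      rw [hfu, h0, zero_dotProduct, LinearMap.zero_apply])
    rw [← hfu] at hne
    exact hne (hker (Submodule.subset_span ⟨i, hi, rfl⟩))
  obtain ⟨b, hbA, -, hspan, hli⟩ := exists_linearIndepOn_extension
    (K := ZMod p) (v := a) (linearIndepOn_empty _ _) (Set.empty_subset (A : Set ι))
  have hfin : b.Finite := A.finite_toSet.subset hbA
  lift b to Finset ι using hfin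
  refine ⟨b, by exact_mod_cast hbA, ?_, ?_⟩
  · have := LinearIndependent.fintype_card_le_finrank hli
    simpa using this
  · rw [eq_top_iff, ← htop]
    exact Submodule.span_le.2 hspan

theorem const_of_diffMap_eq_zero {ι : Type*} {p : ℕ} [Fact p.Prime] {I : Finset ι}
    {a : ι → Fin 3 → ZMod p} (hI : Submodule.span (ZMod p) (a '' I) = ⊤)
    {f : (Fin 3 → ZMod p) → ZMod p} (hf : ∀ i ∈ I, diffMap (a i) f = 0) (v : Fin 3 → ZMod p) :
    f v = f 0 := by
  let H : AddSubgroup (Fin 3 → ZMod p) :=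
    { carrier := {h | ∀ x, f (x + h) = f x}
      zero_mem' := by simp
      add_mem' := by
        intro v w hv hw x
        rw [← add_assoc, hw, hv]
      neg_mem' := by
        intro v hv x
        rw [← hv, neg_add_cancel_right] }
  have hle : Submodule.span (ZMod p) (a '' I) ≤ AddSubgroup.toZModSubmodule p H := by
    refine Submodule.span_le.2 ?_
    rintro _ ⟨i, hi, rfl⟩ x
    exact sub_eq_zero.1 (congrFun (hf i hi) x)
  rw [hI] at hle
  have hv : v ∈ H := hle (Submodule.mem_top (x := v))
  have := hv 0
  rwa [zero_add] at this

/-- If every plane through `0` contains at most `M` terms, then the sums of at most `k` terms taken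
from suitable `3 k` terms detect all polynomial functions of degree less than `k`. -/
theorem exists_subsumsIn_degLT {ι : Type*} {p M : ℕ} [Fact p.Prime] {A : Finset ι}
    {a : ι → Fin 3 → ZMod p}
    (hA : ∀ u ≠ 0, (A.filter fun i => u ⬝ᵥ a i = 0).card ≤ M) (k : ℕ)
    (hk : M + 3 * k < A.card) :
    ∃ B ⊆ A, B.card ≤ 3 * k ∧ ∃ Y : Finset (Fin 3 → ZMod p), SubsumsIn a B k Y ∧
      ∀ f ∈ degLT (ZMod p) (Fin 3 → ZMod p) k, (∀ y ∈ Y, f y = 0) → f = 0 := by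
  classical
  induction k with
  | zero => exact ⟨∅, by simp, by simp, ∅, by simp [SubsumsIn], fun f hf _ => hf⟩
  | succ k ih =>
    obtain ⟨B, hBA, hBk, Y, hY, hYf⟩ := ih (by omega)
    have hsd := Finset.card_sdiff_of_subset hBA
    obtain ⟨I, hIA, hI3, hI⟩ := exists_spanning_subset (A := A \ B) (a := a) (by
      intro u hu
      by_contra! hcon
      have : (A \ B).card ≤ (A.filter fun i => u ⬝ᵥ a i = 0).card :=
        Finset.card_le_card fun i hi =>
          Finset.mem_filter.2 ⟨(Finset.mem_sdiff.1 hi).1, hcon i hi⟩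
      have := hA u hu
      omega)
    refine ⟨B ∪ I, Finset.union_subset hBA (hIA.trans Finset.sdiff_subset), ?_,
      insert 0 (Y ∪ I.biUnion fun i => Y.image (· + a i)), ?_, ?_⟩
    · have := Finset.card_union_le B I
      omega
    · intro y hy
      rw [Finset.mem_insert, Finset.mem_union, Finset.mem_biUnion] at hy
      rcases hy with rfl | hy | ⟨i, hi, hy⟩
      · exact ⟨∅, by simp, by simp, by simp⟩
      · exact hY.mono Finset.subset_union_left (Nat.le_succ k) y hy
      · refine (hY.image_add (Finset.mem_sdiff.1 (hIA hi)).2).mono ?_ le_rfl y hy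
        exact Finset.insert_subset (Finset.mem_union_right _ hi) Finset.subset_union_left
    · intro f hf hfY
      have hdiff : ∀ i ∈ I, diffMap (a i) f = 0 := by
        intro i hi
        refine hYf _ (mem_degLT_succ.1 hf _) fun y hy => ?_
        have h1 := hfY y (by simp [hy])
        have h2 := hfY (y + a i) (Finset.mem_insert_of_mem (Finset.mem_union_right _
          (Finset.mem_biUnion.2 ⟨i, hi, Finset.mem_image_of_mem _ hy⟩)))
        simp [diffMap, h1, h2]
      ext v
      rw [const_of_diffMap_eq_zero hI hdiff v, hfY 0 (by simp), Pi.zero_apply]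

/-- The number of elements of `Y` moved out of `Y` by the translation by `v`. -/
def escape {M : Type*} [AddCommGroup M] [DecidableEq M] (Y : Finset M) (v : M) : ℕ :=
  (Y.filter fun y => y + v ∉ Y).card

theorem escape_add_le {M : Type*} [AddCommGroup M] [DecidableEq M] (Y : Finset M) (v w : M) :
    escape Y (v + w) ≤ escape Y v + escape Y w := by
  have hsub : (Y.filter fun y => y + (v + w) ∉ Y) ⊆ (Y.filter fun y => y + v ∉ Y) ∪
      (Y.filter fun y => y + w ∉ Y).image (· - v) := by
    intro y hy
    obtain ⟨hy, hyvw⟩ := Finset.mem_filter.1 hy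
    by_cases h : y + v ∈ Y
    · refine Finset.mem_union_right _ (Finset.mem_image.2 ⟨y + v, ?_, add_sub_cancel_right y v⟩)
      exact Finset.mem_filter.2 ⟨h, by rwa [add_assoc]⟩
    · exact Finset.mem_union_left _ (Finset.mem_filter.2 ⟨hy, h⟩)
  exact (Finset.card_le_card hsub).trans ((Finset.card_union_le _ _).trans
    (Nat.add_le_add_left Finset.card_image_le _))

theorem escape_nsmul_le {M : Type*} [AddCommGroup M] [DecidableEq M] (Y : Finset M) (k : ℕ)
    (v : M) : escape Y (k • v) ≤ k * escape Y v := by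
  induction k with
  | zero => simp [escape]
  | succ k ih =>
    rw [succ_nsmul, Nat.succ_mul]
    exact (escape_add_le Y _ _).trans (Nat.add_le_add_right ih _)

theorem card_union_image_add {M : Type*} [AddCommGroup M] [DecidableEq M] (Y : Finset M) (v : M) :
    (Y ∪ Y.image (· + v)).card = Y.card + escape Y v := by
  have h : Y ∪ Y.image (· + v) = Y ∪ (Y.filter fun y => y + v ∉ Y).image (· + v) := by
    ext x
    simp only [Finset.mem_union, Finset.mem_image, Finset.mem_filter]
    constructor
    · rintro (hx | ⟨y, hy, rfl⟩)
      · exact Or.inl hx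
      · by_cases h : y + v ∈ Y
        · exact Or.inl h
        · exact Or.inr ⟨y, ⟨hy, h⟩, rfl⟩
    · rintro (hx | ⟨y, hy, rfl⟩)
      · exact Or.inl hx
      · exact Or.inr ⟨y, hy.1, rfl⟩
  rw [h, Finset.card_union_of_disjoint, Finset.card_image_of_injective _ (add_left_injective v),
    escape]
  rw [Finset.disjoint_right]
  intro x hx
  obtain ⟨y, hy, rfl⟩ := Finset.mem_image.1 hx
  exact (Finset.mem_filter.1 hy).2

/-- The Fourier transform of the indicator function of `Y`. -/
noncomputable def fourierSum {p : ℕ} [NeZero p] (Y : Finset (Fin 3 → ZMod p))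
    (u : Fin 3 → ZMod p) : ℂ :=
  ∑ y ∈ Y, ZMod.stdAddChar (u ⬝ᵥ y)

theorem sum_stdAddChar_dotProduct {p : ℕ} [Fact p.Prime] (v : Fin 3 → ZMod p) :
    ∑ u : Fin 3 → ZMod p, (ZMod.stdAddChar (u ⬝ᵥ v) : ℂ) = if v = 0 then (p : ℂ) ^ 3 else 0 := by
  split_ifs with hv
  · simp [hv]
  · let χ : AddChar (Fin 3 → ZMod p) ℂ :=
      { toFun := fun u => ZMod.stdAddChar (u ⬝ᵥ v)
        map_zero_eq_one' := by simp
        map_add_eq_mul' := fun u w => by rw [add_dotProduct, AddChar.map_add_eq_mul] }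
    have hχ : χ ≠ 0 := by
      obtain ⟨j, hj⟩ := Function.ne_iff.1 hv
      intro h
      have h1 : ZMod.stdAddChar (Pi.single j 1 ⬝ᵥ v) = (1 : ℂ) :=
        DFunLike.congr_fun h (Pi.single j 1)
      rw [single_one_dotProduct, ← AddChar.map_zero_eq_one (ZMod.stdAddChar (N := p))] at h1
      exact hj (ZMod.injective_stdAddChar h1)
    exact AddChar.sum_eq_zero_iff_ne_zero.2 hχ

/-- The number of `y ∈ Y` with `y + v ∈ Y` in terms of Fourier coefficients. -/
theorem sum_norm_fourierSum_sq_mul {p : ℕ} [Fact p.Prime] (Y : Finset (Fin 3 → ZMod p))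
    (v : Fin 3 → ZMod p) :
    ∑ u, ((‖fourierSum Y u‖ ^ 2 : ℝ) : ℂ) * ZMod.stdAddChar (u ⬝ᵥ v) =
      (p : ℂ) ^ 3 * (Y.filter fun y => y + v ∈ Y).card := by
  have h1 : ∀ u, ((‖fourierSum Y u‖ ^ 2 : ℝ) : ℂ) * ZMod.stdAddChar (u ⬝ᵥ v) =
      ∑ y ∈ Y, ∑ x ∈ Y, ZMod.stdAddChar (u ⬝ᵥ (y + v - x)) := by
    intro u
    rw [Complex.ofReal_pow, ← Complex.mul_conj', fourierSum, map_sum, Finset.sum_mul_sum,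
      Finset.sum_mul]
    refine Finset.sum_congr rfl fun y _ => ?_
    rw [Finset.sum_mul]
    refine Finset.sum_congr rfl fun x _ => ?_
    rw [dotProduct_sub, dotProduct_add, sub_eq_add_neg, AddChar.map_add_eq_mul,
      AddChar.map_add_eq_mul, AddChar.map_neg_eq_conj]
    ring
  simp only [h1]
  rw [Finset.sum_comm, Finset.card_filter, Nat.cast_sum, Finset.mul_sum]
  refine Finset.sum_congr rfl fun y _ => ?_
  rw [Finset.sum_comm]
  simp only [sum_stdAddChar_dotProduct, sub_eq_zero]
  rw [Finset.sum_ite_eq]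
  split_ifs <;> simp

theorem sum_norm_fourierSum_sq {p : ℕ} [Fact p.Prime] (Y : Finset (Fin 3 → ZMod p)) :
    ∑ u, ‖fourierSum Y u‖ ^ 2 = (p : ℝ) ^ 3 * Y.card := by
  have h := sum_norm_fourierSum_sq_mul Y 0
  simp only [dotProduct_zero, AddChar.map_zero_eq_one, mul_one, add_zero,
    Finset.filter_mem_eq_inter, Finset.inter_self] at h
  exact_mod_cast h

theorem le_norm_stdAddChar_sub_one {p : ℕ} [NeZero p] (c : ZMod p) :
    4 * (c.valMinAbs.natAbs : ℝ) / p ≤ ‖(ZMod.stdAddChar c : ℂ) - 1‖ := by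
  have hp : (0 : ℝ) < p := Nat.cast_pos.2 (NeZero.pos p)
  have hπ := Real.pi_pos
  have hc : (ZMod.stdAddChar c : ℂ) =
      Complex.exp (Complex.I * (2 * Real.pi * c.valMinAbs / p : ℝ)) := by
    conv_lhs => rw [← ZMod.coe_valMinAbs c, ZMod.stdAddChar_coe]
    congr 1
    push_cast
    ring
  have habs : |(c.valMinAbs : ℝ)| = c.valMinAbs.natAbs := by
    rw [Nat.cast_natAbs, Int.cast_abs]
  have hle : (c.valMinAbs.natAbs : ℝ) * 2 ≤ p := by
    have := ZMod.natAbs_valMinAbs_le c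
    exact_mod_cast (by omega : c.valMinAbs.natAbs * 2 ≤ p)
  have hx : |Real.pi * c.valMinAbs / p| = Real.pi * c.valMinAbs.natAbs / p := by
    rw [abs_div, abs_mul, habs, abs_of_pos hπ, abs_of_pos hp]
  have hsin := Real.mul_abs_le_abs_sin (x := Real.pi * c.valMinAbs / p) (by
    rw [hx, div_le_div_iff₀ hp two_pos]
    nlinarith)
  rw [hc, Complex.norm_exp_I_mul_ofReal_sub_one, Real.norm_eq_abs, abs_mul, abs_two,
    show 2 * Real.pi * c.valMinAbs / p / 2 = Real.pi * c.valMinAbs / p by ring]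
  rw [hx] at hsin
  calc 4 * (c.valMinAbs.natAbs : ℝ) / p
      = 2 * (2 / Real.pi * (Real.pi * c.valMinAbs.natAbs / p)) := by field_simp; ring
    _ ≤ _ := by gcongr

theorem norm_geom_sum_le {z : ℂ} (hz : ‖z‖ = 1) {δ : ℝ} (hδ : 0 < δ) (hz1 : δ ≤ ‖z - 1‖) (K : ℕ) :
    ‖∑ k ∈ Finset.range K, z ^ k‖ ≤ 2 / δ := by
  rw [le_div_iff₀ hδ]
  calc ‖∑ k ∈ Finset.range K, z ^ k‖ * δ ≤ ‖∑ k ∈ Finset.range K, z ^ k‖ * ‖z - 1‖ := by gcongr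
    _ = ‖z ^ K - 1‖ := by rw [← norm_mul, geom_sum_mul]
    _ ≤ ‖z ^ K‖ + ‖(1 : ℂ)‖ := norm_sub_le _ _
    _ = 2 := by rw [norm_pow, hz]; norm_num

/-- If few terms lie on each plane, the character sums over multiples of the terms are small. -/
theorem norm_sum_stdAddChar_le {ι : Type*} {p K : ℕ} [Fact p.Prime] {A : Finset ι}
    {a : ι → Fin 3 → ZMod p} {u : Fin 3 → ZMod p}
    (hA : ∀ c, (A.filter fun i => u ⬝ᵥ a i = c).card ≤ 4 * p) (hcard : 20000 * p ≤ A.card)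
    (hK : p ≤ 625 * K) :
    ‖∑ i ∈ A, ∑ k ∈ Finset.range K, (ZMod.stdAddChar (u ⬝ᵥ a i) : ℂ) ^ k‖ ≤
      3 / 4 * (A.card * K) := by
  classical
  have hp : (0 : ℝ) < p := Nat.cast_pos.2 (Fact.out : p.Prime).pos
  have hnorm : ∀ c : ZMod p, ‖(ZMod.stdAddChar c : ℂ)‖ = 1 := fun c => AddChar.norm_apply _ c
  obtain ⟨P, hP⟩ : ∃ P : ι → Prop, ∀ i, P i ↔ (u ⬝ᵥ a i).valMinAbs.natAbs < 1250 :=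
    ⟨_, fun _ => Iff.rfl⟩
  have hbad : (A.filter P).card ≤ 2499 * (4 * p) := by
    obtain ⟨I, hI, hmem⟩ : ∃ I : Finset ℤ, I.card = 2499 ∧ ∀ c : ℤ, c.natAbs < 1250 → c ∈ I :=
      ⟨Finset.Icc (-1249) 1249, by rw [Int.card_Icc]; omega, fun c hc => by
        rw [Finset.mem_Icc]; omega⟩
    have hsub : A.filter P ⊆ I.biUnion fun c => A.filter fun i => u ⬝ᵥ a i = (c : ZMod p) := by
      intro i hi
      obtain ⟨hiA, hiP⟩ := Finset.mem_filter.1 hi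
      exact Finset.mem_biUnion.2 ⟨(u ⬝ᵥ a i).valMinAbs, hmem _ ((hP i).1 hiP),
        Finset.mem_filter.2 ⟨hiA, (ZMod.coe_valMinAbs _).symm⟩⟩
    rw [← hI]
    exact (Finset.card_le_card hsub).trans
      (Finset.card_biUnion_le_card_mul _ _ _ fun c _ => hA c)
  have hgood : ∀ i ∈ A.filter (fun i => ¬ P i),
      ‖∑ k ∈ Finset.range K, (ZMod.stdAddChar (u ⬝ᵥ a i) : ℂ) ^ k‖ ≤ K / 4 := by
    intro i hi
    have hiP : 1250 ≤ (u ⬝ᵥ a i).valMinAbs.natAbs :=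
      not_lt.1 fun h => (Finset.mem_filter.1 hi).2 ((hP i).2 h)
    have h5000 : 5000 / (p : ℝ) ≤ ‖(ZMod.stdAddChar (u ⬝ᵥ a i) : ℂ) - 1‖ := by
      refine le_trans ?_ (le_norm_stdAddChar_sub_one _)
      have : (1250 : ℝ) ≤ (u ⬝ᵥ a i).valMinAbs.natAbs := by exact_mod_cast hiP
      gcongr
      linarith
    refine (norm_geom_sum_le (hnorm _) (by positivity) h5000 K).trans ?_
    have : (p : ℝ) ≤ 625 * K := by exact_mod_cast hK
    rw [div_div_eq_mul_div, div_le_div_iff₀ (by norm_num) (by norm_num)]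
    linarith
  have htriv : ∀ i ∈ A.filter P,
      ‖∑ k ∈ Finset.range K, (ZMod.stdAddChar (u ⬝ᵥ a i) : ℂ) ^ k‖ ≤ K := by
    intro i _
    refine (norm_sum_le _ _).trans ?_
    simp [hnorm]
  rw [← Finset.sum_filter_add_sum_filter_not A P]
  refine (norm_add_le _ _).trans ?_
  have h1 := norm_sum_le_of_le _ htriv
  have h2 := norm_sum_le_of_le _ hgood
  rw [Finset.sum_const, nsmul_eq_mul] at h1 h2
  have h3 : ((A.filter P).card : ℝ) * 2 ≤ A.card := by exact_mod_cast (by omega)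
  have h4 : ((A.filter P).card : ℝ) + (A.filter fun i => ¬ P i).card = A.card := by
    exact_mod_cast Finset.card_filter_add_card_filter_not (s := A) P
  have hK0 : (0 : ℝ) ≤ K := Nat.cast_nonneg K
  nlinarith

/-- Averaged autocorrelation of `Y` along multiples of the terms, bounded by Fourier analysis. -/
theorem sum_autocorrelation_le {ι : Type*} {p K : ℕ} [Fact p.Prime] {A : Finset ι}
    {a : ι → Fin 3 → ZMod p} (Y : Finset (Fin 3 → ZMod p)) {N : ℝ} (hN : N = A.card * K)
    (hA : ∀ u ≠ 0,
      ‖∑ i ∈ A, ∑ k ∈ Finset.range K, (ZMod.stdAddChar (u ⬝ᵥ a i) : ℂ) ^ k‖ ≤ 3 / 4 * N) :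
    (p : ℝ) ^ 3 * ∑ i ∈ A, ∑ k ∈ Finset.range K,
        ((Y.filter fun y => y + k • a i ∈ Y).card : ℝ) ≤
      N * (3 / 4 * (p ^ 3 * Y.card) + 1 / 4 * Y.card ^ 2) := by
  have hfourier : (p : ℂ) ^ 3 * ∑ i ∈ A, ∑ k ∈ Finset.range K,
        ((Y.filter fun y => y + k • a i ∈ Y).card : ℂ) =
      ∑ u, ((‖fourierSum Y u‖ ^ 2 : ℝ) : ℂ) *
        ∑ i ∈ A, ∑ k ∈ Finset.range K, (ZMod.stdAddChar (u ⬝ᵥ a i) : ℂ) ^ k := by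
    simp only [Finset.mul_sum]
    rw [Finset.sum_comm (s := Finset.univ)]
    refine Finset.sum_congr rfl fun i _ => ?_
    rw [Finset.sum_comm (s := Finset.univ)]
    refine Finset.sum_congr rfl fun k _ => ?_
    rw [← sum_norm_fourierSum_sq_mul]
    simp only [dotProduct_smul, AddChar.map_nsmul_eq_pow]
  have hup : (p : ℝ) ^ 3 * ∑ i ∈ A, ∑ k ∈ Finset.range K,
        ((Y.filter fun y => y + k • a i ∈ Y).card : ℝ) ≤
      ∑ u, ‖fourierSum Y u‖ ^ 2 * (if u = 0 then N else 3 / 4 * N) := by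
    have hnn : 0 ≤ (p : ℝ) ^ 3 * ∑ i ∈ A, ∑ k ∈ Finset.range K,
        ((Y.filter fun y => y + k • a i ∈ Y).card : ℝ) := by
      positivity
    rw [← Complex.norm_of_nonneg hnn]
    push_cast
    rw [hfourier]
    refine norm_sum_le_of_le _ fun u _ => ?_
    rw [norm_mul, Complex.norm_of_nonneg (sq_nonneg _)]
    refine mul_le_mul_of_nonneg_left ?_ (sq_nonneg _)
    split_ifs with hu
    · refine le_of_eq ?_
      rw [hu, hN]
      simp only [zero_dotProduct, AddChar.map_zero_eq_one, one_pow, Finset.sum_const,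
        Finset.card_range, nsmul_eq_mul, mul_one]
      rw [← Nat.cast_mul, Complex.norm_natCast, Nat.cast_mul]
    · exact hA u hu
  refine hup.trans (le_of_eq ?_)
  have h0 : ‖fourierSum Y 0‖ = Y.card := by simp [fourierSum]
  have : ∀ u, ‖fourierSum Y u‖ ^ 2 * (if u = 0 then N else 3 / 4 * N) =
      3 / 4 * N * ‖fourierSum Y u‖ ^ 2 +
        if u = 0 then 1 / 4 * N * ‖fourierSum Y 0‖ ^ 2 else 0 := by
    intro u
    split_ifs with hu
    · rw [hu]; ring
    · ring
  simp only [this]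
  rw [Finset.sum_add_distrib, ← Finset.mul_sum, sum_norm_fourierSum_sq, Finset.sum_ite_eq',
    if_pos (Finset.mem_univ _), h0]
  ring

/-- Expansion: if few terms lie on each plane, some term moves a positive proportion of order
`1 / p` of any set `Y` of density at most one half out of `Y`. -/
theorem exists_escape_ge {ι : Type*} {p K : ℕ} [Fact p.Prime] {A : Finset ι}
    {a : ι → Fin 3 → ZMod p}
    (hA : ∀ u ≠ 0, ∀ c, (A.filter fun i => u ⬝ᵥ a i = c).card ≤ 4 * p)
    (hcard : 20000 * p ≤ A.card) (hK : p ≤ 625 * (K + 1)) {Y : Finset (Fin 3 → ZMod p)}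
    (hY : 2 * Y.card ≤ p ^ 3) :
    ∃ i ∈ A, Y.card ≤ 8 * K * escape Y (a i) := by
  by_contra! hcon
  have hp := (Fact.out : p.Prime).pos
  have hApos : 0 < A.card := by omega
  obtain ⟨i₀, hi₀⟩ := Finset.card_pos.1 hApos
  have hYpos : (0 : ℝ) < Y.card := by exact_mod_cast (Nat.zero_le _).trans_lt (hcon i₀ hi₀)
  set R : (Fin 3 → ZMod p) → ℕ := fun v => (Y.filter fun y => y + v ∈ Y).card with hR
  have hResc : ∀ v, R v + escape Y v = Y.card := fun v =>
    Finset.card_filter_add_card_filter_not _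
  have hlow : ∀ i ∈ A, ∀ k ∈ Finset.range (K + 1), 7 / 8 * (Y.card : ℝ) < R (k • a i) := by
    intro i hi k hk
    have h1 := hResc (k • a i)
    have h2 := escape_nsmul_le Y k (a i)
    have h3 := Nat.mul_le_mul_right (escape Y (a i)) (Nat.lt_succ_iff.1 (Finset.mem_range.1 hk))
    have h4 := hcon i hi
    have h5 : 7 * Y.card < 8 * R (k • a i) := by nlinarith
    have h6 : (7 : ℝ) * Y.card < 8 * R (k • a i) := by exact_mod_cast h5
    linarith
  set N : ℝ := A.card * (K + 1 : ℕ) with hN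
  have hNpos : 0 < N := by positivity
  have hsumlow : N * (7 / 8 * Y.card) < ∑ i ∈ A, ∑ k ∈ Finset.range (K + 1), (R (k • a i) : ℝ) := by
    have : N * (7 / 8 * Y.card) = ∑ i ∈ A, ∑ k ∈ Finset.range (K + 1), 7 / 8 * (Y.card : ℝ) := by
      simp only [Finset.sum_const, Finset.card_range, nsmul_eq_mul, hN]
      ring
    rw [this]
    exact Finset.sum_lt_sum_of_nonempty ⟨i₀, hi₀⟩ fun i hi =>
      Finset.sum_lt_sum_of_nonempty ⟨0, by simp⟩ (hlow i hi)
  have hup := sum_autocorrelation_le (K := K + 1) Y hN fun u hu =>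
    norm_sum_stdAddChar_le (hA u hu) hcard hK
  have hp3 : (0 : ℝ) < (p : ℝ) ^ 3 := by positivity
  have hY' : 2 * (Y.card : ℝ) ≤ (p : ℝ) ^ 3 := by exact_mod_cast hY
  have h1 := mul_lt_mul_of_pos_left hsumlow hp3
  have h2 : N * (3 / 4 * ((p : ℝ) ^ 3 * Y.card) + 1 / 4 * (Y.card : ℝ) ^ 2) ≤
      (p : ℝ) ^ 3 * (N * (7 / 8 * Y.card)) := by
    have : (Y.card : ℝ) * (2 * Y.card) ≤ Y.card * p ^ 3 := by gcongr
    nlinarith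
  linarith

theorem two_mul_pow_self_le (D : ℕ) (hD : 0 < D) : 2 * D ^ D ≤ (D + 1) ^ D := by
  have hD' : (0 : ℝ) < D := Nat.cast_pos.2 hD
  have h := one_add_mul_le_pow (a := 1 / (D : ℝ)) (by have := one_div_pos.2 hD'; linarith) D
  rw [mul_one_div_cancel hD'.ne', one_add_one_eq_two, one_add_div hD'.ne', div_pow,
    le_div_iff₀ (by positivity)] at h
  exact_mod_cast h

/-- Iterating the expansion: the set of subsums grows by a factor `1 + 1 / D` for every new term,
until it fills more than half of the group. -/
theorem exists_subsumsIn_growth {ι : Type*} {p D : ℕ} [Fact p.Prime] (hD : 8 * (p / 625) ≤ D)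
    {A : Finset ι} {a : ι → Fin 3 → ZMod p}
    (hA : ∀ u ≠ 0, ∀ c, (A.filter fun i => u ⬝ᵥ a i = c).card ≤ 4 * p)
    (hcard : 20001 * p ≤ A.card) {B₀ : Finset ι} {r : ℕ} {Y₀ : Finset (Fin 3 → ZMod p)}
    (hB₀ : B₀ ⊆ A) (hY₀ : SubsumsIn a B₀ r Y₀) (t : ℕ) (ht : B₀.card + t ≤ p) :
    ∃ B ⊆ A, B.card ≤ B₀.card + t ∧ ∃ Y, SubsumsIn a B (r + t) Y ∧
      (p ^ 3 < 2 * Y.card ∨ (D + 1) ^ t * Y₀.card ≤ D ^ t * Y.card) := by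
  classical
  induction t with
  | zero => exact ⟨B₀, hB₀, le_rfl, Y₀, hY₀, Or.inr (by simp)⟩
  | succ t ih =>
    obtain ⟨B, hBA, hB, Y, hY, hgrow⟩ := ih (by omega)
    by_cases hhalf : p ^ 3 < 2 * Y.card
    · exact ⟨B, hBA, by omega, Y, hY.mono subset_rfl (by omega), Or.inl hhalf⟩
    have hgrow := hgrow.resolve_left hhalf
    have hsub : A \ B ⊆ A := Finset.sdiff_subset
    have hcard' : 20000 * p ≤ (A \ B).card := by
      have := Finset.le_card_sdiff B A
      omega
    obtain ⟨i, hi, hesc⟩ := exists_escape_ge (K := p / 625)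
      (fun u hu c => (Finset.card_le_card (Finset.filter_subset_filter _ hsub)).trans (hA u hu c))
      hcard' (by omega) (not_lt.1 hhalf)
    obtain ⟨hiA, hiB⟩ := Finset.mem_sdiff.1 hi
    refine ⟨insert i B, Finset.insert_subset hiA hBA, ?_, Y ∪ Y.image (· + a i), ?_, Or.inr ?_⟩
    · rw [Finset.card_insert_of_notMem hiB]
      omega
    · exact (hY.mono (Finset.subset_insert i B) (by omega)).union (hY.image_add hiB)
    · rw [card_union_image_add]
      have h1 : Y.card ≤ D * escape Y (a i) := hesc.trans (Nat.mul_le_mul_right _ hD)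
      calc (D + 1) ^ (t + 1) * Y₀.card = (D + 1) * ((D + 1) ^ t * Y₀.card) := by ring
        _ ≤ (D + 1) * (D ^ t * Y.card) := Nat.mul_le_mul_left _ hgrow
        _ = D ^ t * (D * Y.card + Y.card) := by ring
        _ ≤ D ^ t * (D * Y.card + D * escape Y (a i)) :=
          Nat.mul_le_mul_left _ (Nat.add_le_add_left h1 _)
        _ = D ^ (t + 1) * (Y.card + escape Y (a i)) := by ring

/-- If few terms lie on each plane, the subsums of length less than `p / 2` of at most `p` of the
terms already fill more than half of the group. -/
theorem exists_subsumsIn_half {ι : Type*} {p : ℕ} [Fact p.Prime] (hp : 5000 < p)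
    {A : Finset ι} {a : ι → Fin 3 → ZMod p}
    (hA : ∀ u ≠ 0, ∀ c, (A.filter fun i => u ⬝ᵥ a i = c).card ≤ 4 * p)
    (hcard : 20001 * p ≤ A.card) :
    ∃ B ⊆ A, B.card ≤ p ∧ ∃ Y, SubsumsIn a B ((p - 1) / 2) Y ∧ p ^ 3 < 2 * Y.card := by
  obtain ⟨B₀, hB₀A, hB₀, Y₀, hY₀, hvan⟩ := exists_subsumsIn_degLT (fun u hu => hA u hu 0)
    (3 * (p / 48) + 1) (by omega)
  have hm := pow_le_card_of_degLT (by omega) hvan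
  obtain ⟨B, hBA, hB, Y, hY, hgrow⟩ := exists_subsumsIn_growth (D := p / 40) (by omega) hA hcard
    hB₀A hY₀ (16 * (p / 40)) (by omega)
  refine ⟨B, hBA, by omega, Y, hY.mono subset_rfl (by omega), ?_⟩
  refine hgrow.elim id fun hgrow => ?_
  have hD : 0 < p / 40 := by omega
  generalize p / 40 = D at hgrow hD
  have hpow : 2 ^ 16 * D ^ (16 * D) ≤ (D + 1) ^ (16 * D) := by
    rw [mul_comm 16, pow_mul, pow_mul, ← mul_pow]
    exact Nat.pow_le_pow_left (two_mul_pow_self_le D hD) 16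
  have h2 : 2 ^ 16 * Y₀.card ≤ Y.card := by
    refine Nat.le_of_mul_le_mul_left (c := D ^ (16 * D)) ?_ (pow_pos hD _)
    calc D ^ (16 * D) * (2 ^ 16 * Y₀.card) = 2 ^ 16 * D ^ (16 * D) * Y₀.card := by ring
      _ ≤ (D + 1) ^ (16 * D) * Y₀.card := Nat.mul_le_mul_right _ hpow
      _ ≤ _ := hgrow
  have h3 : p ≤ 48 * (p / 48 + 1) := by omega
  have h4 := Nat.pow_le_pow_left h3 3
  rw [mul_pow] at h4
  have h5 : 0 < (p / 48 + 1) ^ 3 := by positivity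
  omega

/-- If few terms lie on each plane, there is a short zero-sum subsequence. -/
theorem exists_zero_sum_of_card_plane_le {ι : Type*} {p : ℕ} [Fact p.Prime] (hp : 5000 < p)
    {s : Finset ι} {a : ι → Fin 3 → ZMod p}
    (hA : ∀ u ≠ 0, ∀ c, (s.filter fun i => u ⬝ᵥ a i = c).card ≤ 4 * p)
    (hs : 20003 * p ≤ s.card) :
    ∃ J ⊆ s, J.Nonempty ∧ J.card ≤ p ∧ ∑ i ∈ J, a i = 0 := by
  classical
  obtain ⟨B₁, hB₁s, hB₁, Y₁, hY₁, hcard₁⟩ := exists_subsumsIn_half hp hA (by omega)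
  have h1 := Finset.le_card_sdiff B₁ s
  obtain ⟨B₂, hB₂s, hB₂, Y₂, hY₂, hcard₂⟩ := exists_subsumsIn_half (A := s \ B₁) hp
    (fun u hu c => (Finset.card_le_card (Finset.filter_subset_filter _
      Finset.sdiff_subset)).trans (hA u hu c)) (by omega)
  have h2 := Finset.le_card_sdiff B₂ (s \ B₁)
  obtain ⟨i, hi⟩ : ((s \ B₁) \ B₂).Nonempty := Finset.card_pos.1 (by omega)
  obtain ⟨hi, hiB₂⟩ := Finset.mem_sdiff.1 hi
  obtain ⟨his, hiB₁⟩ := Finset.mem_sdiff.1 hi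
  obtain ⟨y, hy⟩ : (Y₁ ∩ Y₂.image fun z => -a i - z).Nonempty := by
    rw [← Finset.not_disjoint_iff_nonempty_inter]
    intro hdis
    have h3 := Finset.card_le_univ (Y₁ ∪ Y₂.image fun z => -a i - z)
    rw [Finset.card_union_of_disjoint hdis,
      Finset.card_image_of_injective _ (sub_right_injective (b := -a i))] at h3
    simp only [Fintype.card_pi, ZMod.card, Finset.prod_const, Finset.card_univ,
      Fintype.card_fin] at h3
    omega
  obtain ⟨hy₁, hy₂⟩ := Finset.mem_inter.1 hy
  obtain ⟨z, hz, hzy⟩ := Finset.mem_image.1 hy₂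
  obtain ⟨J₁, hJ₁, hJ₁r, rfl⟩ := hY₁ y hy₁
  obtain ⟨J₂, hJ₂, hJ₂r, rfl⟩ := hY₂ z hz
  have hdis : Disjoint J₁ J₂ := Finset.disjoint_of_subset_left hJ₁
    (Finset.disjoint_of_subset_right (hJ₂.trans hB₂s) Finset.disjoint_sdiff)
  have hiJ : i ∉ J₁ ∪ J₂ := fun h =>
    (Finset.mem_union.1 h).elim (fun h => hiB₁ (hJ₁ h)) fun h => hiB₂ (hJ₂ h)
  refine ⟨insert i (J₁ ∪ J₂), ?_, Finset.insert_nonempty _ _, ?_, ?_⟩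
  · exact Finset.insert_subset his (Finset.union_subset (hJ₁.trans hB₁s)
      (hJ₂.trans (hB₂s.trans Finset.sdiff_subset)))
  · rw [Finset.card_insert_of_notMem hiJ, Finset.card_union_of_disjoint hdis]
    omega
  · rw [Finset.sum_insert hiJ, Finset.sum_union hdis, ← hzy]
    abel

theorem exists_short_zero_sum_two {ι : Type*} {s : Finset ι} (a : ι → Fin 3 → ZMod 2)
    (hs : 8 < s.card) : ∃ J ⊆ s, J.Nonempty ∧ J.card ≤ 2 ∧ ∑ i ∈ J, a i = 0 := by
  classical
  obtain ⟨i, hi, j, hj, hij, h⟩ := Finset.exists_ne_map_eq_of_card_lt_of_maps_to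
    (s := s) (t := (Finset.univ : Finset (Fin 3 → ZMod 2))) (f := a)
    (by simpa [Fintype.card_pi, ZMod.card] using hs) (fun _ _ => Finset.mem_univ _)
  refine ⟨{i, j}, by simp [Finset.insert_subset_iff, hi, hj], by simp, Finset.card_le_two, ?_⟩
  rw [Finset.sum_pair hij, h]
  ext k
  exact CharTwo.add_self_eq_zero _

/-- Any sequence of `20369 (p - 1) + 1` vectors over `ZMod p` has a non-empty zero-sum subsequence
of length at most `p`. -/
theorem exists_short_zero_sum_of_prime {ι : Type*} {p : ℕ} [Fact p.Prime] {s : Finset ι}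
    (a : ι → Fin 3 → ZMod p) (hs : 20369 * (p - 1) + 1 ≤ s.card) :
    ∃ J ⊆ s, J.Nonempty ∧ J.card ≤ p ∧ ∑ i ∈ J, a i = 0 := by
  classical
  have hp := (Fact.out : p.Prime).two_le
  obtain rfl | hp2 := eq_or_ne p 2
  · exact exists_short_zero_sum_two a (by omega)
  by_contra! hcon
  have hplane : ∀ u ≠ 0, ∀ c, (s.filter fun i => u ⬝ᵥ a i = c).card < 4 * p - 2 := by
    intro u hu c
    by_contra! h
    obtain ⟨J, hJ, hJp, hJ0⟩ := exists_zero_sum_of_affine_plane hp2 hu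
      (fun i hi => (Finset.mem_filter.1 hi).2) h
    exact hcon J (hJ.trans (Finset.filter_subset _ _)) (Finset.card_pos.1 (by omega)) hJp.le hJ0
  rcases le_or_gt p 5000 with hp5000 | hp5000
  · have hsum := Finset.card_eq_sum_card_fiberwise (s := s) (t := Finset.univ)
      (f := fun i => (Pi.single 0 1 : Fin 3 → ZMod p) ⬝ᵥ a i) (fun _ _ => Finset.mem_univ _)
    have hle : s.card ≤ p * (4 * p - 3) := by
      rw [hsum]
      refine (Finset.sum_le_card_nsmul _ _ (4 * p - 3) fun c _ => ?_).trans_eq ?_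
      · have := hplane (Pi.single 0 1) (by simp) c
        omega
      · rw [Finset.card_univ, ZMod.card, smul_eq_mul]
    obtain ⟨q, rfl⟩ := Nat.exists_eq_add_of_le hp
    obtain ⟨r, hr⟩ := Nat.exists_eq_add_of_le hp5000
    rw [show 4 * (2 + q) - 3 = 4 * q + 5 by omega] at hle
    rw [show 2 + q - 1 = q + 1 by omega] at hs
    nlinarith
  · obtain ⟨J, hJ, hJn, hJp, hJ0⟩ := exists_zero_sum_of_card_plane_le hp5000
      (fun u hu c => (hplane u hu c).le.trans (by omega)) (by omega : 20003 * p ≤ s.card)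
    exact hcon J hJ hJn hJp hJ0

/-- Every sequence of length at least `t` over `M` has a non-empty subsequence of length at most
`e` whose sum is divisible by `n`. -/
def HasSumDvd (M : Type*) [AddCommGroup M] (n t e : ℕ) : Prop :=
  ∀ (ι : Type) (s : Finset ι) (a : ι → M), t ≤ s.card →
    ∃ J ⊆ s, J.Nonempty ∧ J.card ≤ e ∧ ∃ b, ∑ i ∈ J, a i = n • b

theorem HasSumDvd.exists_blocks {M : Type*} [AddCommGroup M] {q t e : ℕ} (h : HasSumDvd M q t e)
    {ι : Type} (s : Finset ι) (a : ι → M) (k : ℕ) (hs : t + e * k ≤ s.card + e) :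
    ∃ P : Finset (Finset ι), P.card = k ∧ (P : Set (Finset ι)).PairwiseDisjoint id ∧
      ∀ J ∈ P, J ⊆ s ∧ J.Nonempty ∧ J.card ≤ e ∧ ∃ b, ∑ i ∈ J, a i = q • b := by
  classical
  induction k with
  | zero => exact ⟨∅, by simp⟩
  | succ k ih =>
    rw [Nat.mul_succ] at hs
    obtain ⟨P, hPk, hPd, hP⟩ := ih (by omega)
    have hcard : (P.biUnion id).card ≤ e * k := by
      rw [mul_comm, ← hPk]
      exact Finset.card_biUnion_le_card_mul _ _ _ fun J hJ => (hP J hJ).2.2.1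
    have hsd := Finset.le_card_sdiff (P.biUnion id) s
    obtain ⟨J, hJ, hJn, hJe⟩ := h ι (s \ P.biUnion id) a (by omega)
    have hdis : ∀ I ∈ P, Disjoint J I := fun I hI =>
      Finset.disjoint_of_subset_left hJ (Finset.disjoint_of_subset_right
        (Finset.subset_biUnion_of_mem id hI) Finset.sdiff_disjoint)
    have hJP : J ∉ P := fun hmem =>
      hJn.ne_empty (Finset.disjoint_self_iff_empty _ |>.1 (hdis J hmem))
    refine ⟨insert J P, by rw [Finset.card_insert_of_notMem hJP, hPk], ?_, ?_⟩
    · rw [Finset.coe_insert]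
      exact hPd.insert fun I hI _ => hdis I hI
    · intro I hI
      obtain rfl | hI := Finset.mem_insert.1 hI
      · exact ⟨hJ.trans Finset.sdiff_subset, hJn, hJe⟩
      · exact hP I hI

theorem HasSumDvd.mul {M : Type*} [AddCommGroup M] {q m t₁ e₁ t₂ e₂ t : ℕ}
    (hq : HasSumDvd M q t₁ e₁) (hm : HasSumDvd M m t₂ e₂) (ht : t₁ + e₁ * t₂ ≤ t + e₁) :
    HasSumDvd M (q * m) t (e₁ * e₂) := by
  classical
  intro ι s a hs
  obtain ⟨P, hPk, hPd, hP⟩ := hq.exists_blocks s a t₂ (by omega)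
  choose! hPs hPn hPe b hb using hP
  obtain ⟨Q, hQP, hQn, hQe, c, hc⟩ := hm (Finset ι) P b hPk.ge
  refine ⟨Q.biUnion id, Finset.biUnion_subset.2 fun J hJ => hPs J (hQP hJ), ?_, ?_, c, ?_⟩
  · exact hQn.biUnion fun J hJ => hPn J (hQP hJ)
  · refine (Finset.card_biUnion_le_card_mul _ _ e₁ fun J hJ => hPe J (hQP hJ)).trans ?_
    rw [mul_comm]
    exact Nat.mul_le_mul_left _ hQe
  · rw [Finset.sum_biUnion (hPd.subset hQP), mul_nsmul', ← hc, ← Finset.sum_nsmul]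
    exact Finset.sum_congr rfl fun J hJ => hb J (hQP hJ)

theorem HasSumDvd.mono {M : Type*} [AddCommGroup M] {q t t' e e' : ℕ} (h : HasSumDvd M q t e)
    (ht : t ≤ t') (he : e ≤ e') : HasSumDvd M q t' e' := fun ι s a hs =>
  let ⟨J, hJ, hJn, hJe, hb⟩ := h ι s a (ht.trans hs)
  ⟨J, hJ, hJn, hJe.trans he, hb⟩

theorem exists_sum_eq_nsmul {ι : Type*} {q : ℕ} (a : ι → Fin 3 → ℤ) {J : Finset ι}
    (h : ∑ i ∈ J, (fun k => (a i k : ZMod q)) = 0) : ∃ b, ∑ i ∈ J, a i = q • b := by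
  have hdvd : ∀ k, (q : ℤ) ∣ ∑ i ∈ J, a i k := by
    intro k
    rw [← ZMod.intCast_zmod_eq_zero_iff_dvd, Int.cast_sum]
    simpa using congrFun h k
  choose b hb using hdvd
  refine ⟨b, ?_⟩
  ext k
  simp [hb]

/-- Among `20369 (n - 1) + 1` integer vectors, the sum of some at most `n` of them is divisible by
`n`. -/
theorem hasSumDvd_short {n : ℕ} (hn : n ≠ 0) :
    HasSumDvd (Fin 3 → ℤ) n (20369 * (n - 1) + 1) n := by
  induction n using Nat.recOnMul with
  | zero => exact absurd rfl hn
  | one =>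
    intro ι s a hs
    obtain ⟨i, hi⟩ := Finset.card_pos.1 (by omega : 0 < s.card)
    exact ⟨{i}, by simpa using hi, by simp, by simp, a i, by simp⟩
  | prime p hp =>
    have := Fact.mk hp
    intro ι s a hs
    obtain ⟨J, hJ, hJn, hJp, h⟩ :=
      exists_short_zero_sum_of_prime (fun i k => (a i k : ZMod p)) hs
    exact ⟨J, hJ, hJn, hJp, exists_sum_eq_nsmul a h⟩
  | mul q m hq hm =>
    obtain ⟨hq0, hm0⟩ := mul_ne_zero_iff.1 hn
    refine (hq hq0).mul (hm hm0) ?_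
    obtain ⟨q, rfl⟩ := Nat.exists_eq_succ_of_ne_zero hq0
    obtain ⟨m, rfl⟩ := Nat.exists_eq_succ_of_ne_zero hm0
    rw [show (q + 1) * (m + 1) - 1 = q * m + q + m by
      rw [show (q + 1) * (m + 1) = q * m + q + m + 1 by ring]; omega]
    simp only [Nat.succ_eq_add_one, Nat.add_sub_cancel]
    nlinarith

/-- Among `3 ^ ω(n) (n - 1) + 1` integer vectors, the sum of some of them is divisible by `n`. -/
theorem hasSumDvd_primeFactors {n : ℕ} (hn : n ≠ 0) :
    HasSumDvd (Fin 3 → ℤ) n (3 ^ n.primeFactors.card * (n - 1) + 1)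
      (3 ^ n.primeFactors.card * (n - 1) + 1) := by
  induction n using Nat.recOnPosPrimePosCoprime with
  | zero => exact absurd rfl hn
  | one =>
    intro ι s a hs
    obtain ⟨i, hi⟩ := Finset.card_pos.1 (by omega : 0 < s.card)
    exact ⟨{i}, by simpa using hi, by simp, by simp, a i, by simp⟩
  | prime_pow p k hp hk =>
    have := Fact.mk hp
    intro ι s a hs
    rw [Nat.primeFactors_prime_pow hk.ne' hp, Finset.card_singleton, pow_one] at hs ⊢
    obtain ⟨s', hs', hcard⟩ := Finset.exists_subset_card_eq hs
    obtain ⟨J, hJ, hJn, h⟩ :=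
      exists_zero_sum_of_primePow rfl s' (fun i k => (a i k : ZMod _)) hcard.ge
    exact ⟨J, hJ.trans hs', hJn, (Finset.card_le_card hJ).trans hcard.le,
      exists_sum_eq_nsmul a h⟩
  | coprime q m hq1 hm1 hqm hq hm =>
    rw [hqm.primeFactors_mul, Finset.card_union_of_disjoint hqm.disjoint_primeFactors, pow_add]
    have hA : 0 < 3 ^ q.primeFactors.card := by positivity
    have hB : 0 < 3 ^ m.primeFactors.card := by positivity
    have hq := hq (by omega)
    have hm := hm (by omega)
    generalize 3 ^ q.primeFactors.card = A at *
    generalize 3 ^ m.primeFactors.card = B at *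
    obtain ⟨q, rfl⟩ := Nat.exists_eq_add_of_le' hq1.le
    obtain ⟨m, rfl⟩ := Nat.exists_eq_add_of_le' hm1.le
    have hle : (A * q + 1) * (B * m + 1) ≤ A * B * (q * m + q + m) + 1 := by
      have h1 : A * q ≤ A * q * B := Nat.le_mul_of_pos_right _ hB
      have h2 : B * m ≤ B * m * A := Nat.le_mul_of_pos_right _ hA
      nlinarith
    rw [show (q + 1) * (m + 1) - 1 = q * m + q + m by
      rw [show (q + 1) * (m + 1) = q * m + q + m + 1 by ring]; omega]
    rw [Nat.add_sub_cancel] at hq hm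
    exact (hq.mul hm (t := (A * q + 1) * (B * m + 1)) (by nlinarith)).mono hle hle

theorem exists_le_sum_eq_zero_of_hasSumDvd {n t e : ℕ} [NeZero n]
    (h : HasSumDvd (Fin 3 → ℤ) n t e) (S : Multiset (ZMod n × ZMod n × ZMod n))
    (hS : t ≤ Multiset.card S) : ∃ T ≤ S, T ≠ 0 ∧ T.sum = 0 := by
  obtain ⟨l, rfl⟩ := Quot.exists_rep S
  let a : Fin l.length → Fin 3 → ℤ := fun i =>
    ![((l.get i).1.val : ℤ), ((l.get i).2.1.val : ℤ), ((l.get i).2.2.val : ℤ)]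
  obtain ⟨J, -, hJn, -, b, hb⟩ := h (Fin l.length) Finset.univ a (by simpa using hS)
  have hzero : ∀ k, ∑ i ∈ J, (a i k : ZMod n) = 0 := by
    intro k
    have := congrArg (Int.cast : ℤ → ZMod n) (congrFun hb k)
    simpa using this
  refine ⟨J.val.map l.get, ?_, by simpa using hJn.ne_empty, ?_⟩
  · have hle : J.val.map l.get ≤ (Finset.univ : Finset (Fin l.length)).val.map l.get :=
      Multiset.map_le_map (Finset.val_le_iff.2 (Finset.subset_univ J))
    rwa [Fin.univ_val_map, List.ofFn_get] at hle
  · change ∑ i ∈ J, l.get i = 0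
    have h0 := hzero 0
    have h1 := hzero 1
    have h2 := hzero 2
    simp only [a, Matrix.cons_val, Int.cast_natCast, ZMod.natCast_zmod_val] at h0 h1 h2
    ext
    · simpa [Prod.fst_sum] using h0
    · simpa [Prod.fst_sum, Prod.snd_sum] using h1
    · simpa [Prod.snd_sum] using h2

theorem Multiset.exists_eq_add_of_le_add {α : Type*} {T A B : Multiset α} (h : T ≤ A + B) :
    ∃ T₁ ≤ A, ∃ T₂ ≤ B, T₁ + T₂ = T := by
  classical
  exact ⟨T ∩ A, Multiset.inter_le_right, T - A, tsub_le_iff_left.2 h,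
    by rw [add_comm, Multiset.sub_add_inter]⟩

/-- A sub-multiset of `n - 1` copies of each basis vector has sum zero only if it is empty. -/
theorem eq_zero_of_le_replicate_basis {n : ℕ} (hn : 2 ≤ n)
    {T : Multiset (ZMod n × ZMod n × ZMod n)}
    (hT : T ≤ Multiset.replicate (n - 1) (1, 0, 0) + (Multiset.replicate (n - 1) (0, 1, 0) +
      Multiset.replicate (n - 1) (0, 0, 1))) (h0 : T.sum = 0) : T = 0 := by
  have hcast : ∀ k ≤ n - 1, (k : ZMod n) = 0 → k = 0 := fun k hk h =>
    Nat.eq_zero_of_dvd_of_lt ((ZMod.natCast_eq_zero_iff _ _).1 h) (by omega)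
  obtain ⟨T₁, hT₁, T', hT', rfl⟩ := Multiset.exists_eq_add_of_le_add hT
  obtain ⟨T₂, hT₂, T₃, hT₃, rfl⟩ := Multiset.exists_eq_add_of_le_add hT'
  obtain ⟨i, hi, rfl⟩ := Multiset.le_replicate_iff.1 hT₁
  obtain ⟨j, hj, rfl⟩ := Multiset.le_replicate_iff.1 hT₂
  obtain ⟨k, hk, rfl⟩ := Multiset.le_replicate_iff.1 hT₃
  simp only [Multiset.sum_add, Multiset.sum_replicate, Prod.smul_mk, Prod.mk_add_mk, nsmul_one,
    smul_zero, add_zero, zero_add, Prod.mk_eq_zero] at h0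
  obtain ⟨h1, h2, h3⟩ := h0
  simp [hcast _ hi h1, hcast _ hj h2, hcast _ hk h3]

theorem stmt_15 (n : ℕ) (hn : 2 ≤ n) :
    3 * (n - 1) + 1 ≤ Davenport (ZMod n × ZMod n × ZMod n) ∧
      Davenport (ZMod n × ZMod n × ZMod n) ≤
        min 20369 (3 ^ n.primeFactors.card) * (n - 1) + 1 := by
  have hn0 : n ≠ 0 := by omega
  have := NeZero.mk hn0
  have hmem : min 20369 (3 ^ n.primeFactors.card) * (n - 1) + 1 ∈
      {t | ∀ S : Multiset (ZMod n × ZMod n × ZMod n), t ≤ Multiset.card S →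
        ∃ T ≤ S, T ≠ 0 ∧ T.sum = 0} := by
    rcases min_choice 20369 (3 ^ n.primeFactors.card) with h | h <;> rw [h]
    · exact exists_le_sum_eq_zero_of_hasSumDvd (hasSumDvd_short hn0)
    · exact exists_le_sum_eq_zero_of_hasSumDvd (hasSumDvd_primeFactors hn0)
  refine ⟨le_csInf ⟨_, hmem⟩ fun t ht => ?_, Nat.sInf_le hmem⟩
  by_contra! hlt
  obtain ⟨T, hT, hT0, hsum⟩ := ht (Multiset.replicate (n - 1) (1, 0, 0) +
    (Multiset.replicate (n - 1) (0, 1, 0) + Multiset.replicate (n - 1) (0, 0, 1)))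
    (by simp only [Multiset.card_add, Multiset.card_replicate]; omega)
  exact hT0 (eq_zero_of_le_replicate_basis hn hT hsum)
end

section
/- Let F be a set of 3 primes and n ≥ 2. Any sequence of min{20369, 3^{ω(n)}}·(n−1) + 1 positive integers all of whose prime factors lie in F has a non-empty subsequence whose product is a perfect n-th power. -/
/-- `HasShortZeroSum κ n c K`: more than `K` integer vectors with coordinates in `κ` always have a
non-empty subfamily of at most `c` members whose sum vanishes modulo `n`. -/
def HasShortZeroSum (κ : Type) (n c K : ℕ) : Prop :=
  ∀ (ι : Type) (s : Finset ι) (f : ι → κ → ℤ), K < s.card →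
    ∃ t ⊆ s, t.Nonempty ∧ t.card ≤ c ∧ ∀ j, (n : ℤ) ∣ ∑ i ∈ t, f i j

namespace HasShortZeroSum

variable {κ : Type}

theorem mono {n c K c' K' : ℕ} (h : HasShortZeroSum κ n c K) (hc : c ≤ c') (hK : K ≤ K') :
    HasShortZeroSum κ n c' K' := fun ι s f hs => by
  obtain ⟨t, hts, ht, htc, hd⟩ := h ι s f (hK.trans_lt hs)
  exact ⟨t, hts, ht, htc.trans hc, hd⟩

theorem exists_disjoint_blocks {m c K : ℕ} (h : HasShortZeroSum κ m c K) {ι : Type}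
    (f : ι → κ → ℤ) (k : ℕ) (s : Finset ι) (hs : c * k + K < s.card) :
    ∃ T : Finset (Finset ι), T.card = k + 1 ∧ (T : Set (Finset ι)).PairwiseDisjoint id ∧
      ∀ t ∈ T, t ⊆ s ∧ t.Nonempty ∧ t.card ≤ c ∧ ∀ j, (m : ℤ) ∣ ∑ i ∈ t, f i j := by
  classical
  induction k generalizing s with
  | zero =>
    obtain ⟨t, ht⟩ := h ι s f (by simpa using hs)
    exact ⟨{t}, by simp, by simp, by simpa using ht⟩
  | succ k ih =>
    obtain ⟨t, hts, htn, htc, htd⟩ := h ι s f (lt_of_le_of_lt (Nat.le_add_left _ _) hs)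
    have hcard : c * k + K < (s \ t).card := by
      rw [Finset.card_sdiff_of_subset hts]
      rw [mul_add_one] at hs
      omega
    obtain ⟨T, hTc, hTd, hT⟩ := ih (s \ t) hcard
    have hdisj : ∀ u ∈ T, Disjoint t u := fun u hu =>
      Finset.disjoint_sdiff.mono_right (hT u hu).1
    have htT : t ∉ T := fun hmem => htn.ne_empty (disjoint_self.mp (hdisj t hmem))
    refine ⟨insert t T, by rw [Finset.card_insert_of_notMem htT, hTc], ?_, ?_⟩
    · rw [Finset.coe_insert]
      exact hTd.insert fun u hu _ => hdisj u hu
    · intro u hu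
      rcases Finset.mem_insert.mp hu with rfl | hu
      · exact ⟨hts, htn, htc, htd⟩
      · exact ⟨(hT u hu).1.trans Finset.sdiff_subset, (hT u hu).2⟩

theorem mul {m n c₁ c₂ K₁ K₂ : ℕ} (h₁ : HasShortZeroSum κ m c₁ K₁)
    (h₂ : HasShortZeroSum κ n c₂ K₂) : HasShortZeroSum κ (m * n) (c₁ * c₂) (c₁ * K₂ + K₁) := by
  classical
  intro ι s f hs
  obtain ⟨T, hTc, hTd, hT⟩ := h₁.exists_disjoint_blocks f K₂ s hs
  obtain ⟨T', hT'T, hT'n, hT'c, hT'd⟩ :=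
    h₂ (Finset ι) T (fun t j => (∑ i ∈ t, f i j) / m) (by omega)
  refine ⟨T'.biUnion id, ?_, ?_, ?_, fun j => ?_⟩
  · exact Finset.biUnion_subset.mpr fun t ht => (hT t (hT'T ht)).1
  · obtain ⟨t, ht⟩ := hT'n
    exact ((hT t (hT'T ht)).2.1).mono (Finset.subset_biUnion_of_mem id ht)
  · calc (T'.biUnion id).card ≤ T'.card * c₁ :=
          Finset.card_biUnion_le_card_mul _ _ _ fun t ht => (hT t (hT'T ht)).2.2.1
      _ ≤ c₁ * c₂ := by rw [mul_comm]; gcongr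
  · rw [Finset.sum_biUnion (hTd.subset (by exact_mod_cast hT'T))]
    have : ∑ t ∈ T', ∑ i ∈ id t, f i j = m * ∑ t ∈ T', (∑ i ∈ t, f i j) / m := by
      rw [Finset.mul_sum]
      exact Finset.sum_congr rfl fun t ht =>
        (Int.mul_ediv_cancel' ((hT t (hT'T ht)).2.2.2 j)).symm
    rw [this, Nat.cast_mul]
    exact mul_dvd_mul_left _ (hT'd j)

theorem one (κ : Type) : HasShortZeroSum κ 1 1 0 := fun ι s f hs => by
  obtain ⟨i, hi⟩ := Finset.card_pos.mp hs
  exact ⟨{i}, by simpa using hi, by simp, by simp, by simp⟩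

/-- Among more than `n ^ |κ| * (n - 1)` vectors, some `n` are congruent modulo `n`. -/
theorem of_pigeonhole [Fintype κ] {n : ℕ} (hn : 0 < n) :
    HasShortZeroSum κ n n (n ^ Fintype.card κ * (n - 1)) := by
  classical
  intro ι s f hs
  have : NeZero n := ⟨hn.ne'⟩
  obtain ⟨y, -, hy⟩ := Finset.exists_lt_card_fiber_of_mul_lt_card_of_maps_to (s := s)
    (t := (Finset.univ : Finset (κ → ZMod n))) (f := fun i j => (f i j : ZMod n)) (n := n - 1)
    (fun _ _ => Finset.mem_univ _) (by simpa [ZMod.card] using hs)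
  obtain ⟨t, hts, htc⟩ := Finset.exists_subset_card_eq (Nat.le_of_pred_lt hy)
  refine ⟨t, hts.trans (Finset.filter_subset _ _), Finset.card_pos.mp (htc ▸ hn), htc.le,
    fun j => ?_⟩
  rw [← ZMod.intCast_zmod_eq_zero_iff_dvd, Int.cast_sum, Finset.sum_congr rfl (g := fun _ => y j)]
  · simp [htc]
  · intro i hi
    exact congrFun (Finset.mem_filter.mp (hts hi)).2 j

theorem of_primeFactors_le [Fintype κ] {P b : ℕ} (hb : b ≠ 0) (hP : ∀ p ∈ b.primeFactors, p ≤ P) :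
    HasShortZeroSum κ b b (P ^ Fintype.card κ * (b - 1)) := by
  induction b using Nat.recOnMul with
  | zero => exact absurd rfl hb
  | one => simpa using one κ
  | prime p hp =>
    refine (of_pigeonhole hp.pos).mono le_rfl ?_
    gcongr
    exact hP p (by simp [hp.primeFactors])
  | mul a b iha ihb =>
    have ha : a ≠ 0 := left_ne_zero_of_mul hb
    have hb' : b ≠ 0 := right_ne_zero_of_mul hb
    rw [Nat.primeFactors_mul ha hb'] at hP
    have h := (iha ha fun p hp => hP p (Finset.mem_union_left _ hp)).mul
      (ihb hb' fun p hp => hP p (Finset.mem_union_right _ hp))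
    refine h.mono le_rfl (le_of_eq ?_)
    obtain ⟨a, rfl⟩ := Nat.exists_eq_succ_of_ne_zero ha
    obtain ⟨b, rfl⟩ := Nat.exists_eq_succ_of_ne_zero hb'
    have : (a + 1) * (b + 1) - 1 = (a + 1) * b + a := by
      rw [mul_add_one]; omega
    simp only [Nat.succ_eq_add_one, Nat.add_sub_cancel, this]
    ring

end HasShortZeroSum

namespace AddMonoidAlgebra

variable {R κ : Type} [CommRing R] [Fintype κ] [DecidableEq κ]

theorem one_sub_single_mem_span (q : ℕ) [NeZero q] (g : κ → ZMod q) :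
    1 - single g (1 : R) ∈ Ideal.span (Set.range fun j : κ =>
      (1 - single (Pi.single j 1) 1 : AddMonoidAlgebra R (κ → ZMod q))) := by
  set I := Ideal.span (Set.range fun j : κ =>
      (1 - single (Pi.single j 1) 1 : AddMonoidAlgebra R (κ → ZMod q))) with hI
  let H : AddSubmonoid (κ → ZMod q) :=
    { carrier := {g | 1 - single g (1 : R) ∈ I}
      zero_mem' := by simp [← one_def]
      add_mem' := fun {a b} ha hb => by
        have : (1 - single (a + b) 1 : AddMonoidAlgebra R (κ → ZMod q)) =
            (1 - single a 1) + single a 1 * (1 - single b 1) := by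
          rw [mul_sub, single_mul_single]
          simp
        rw [Set.mem_ofPred_eq, this]
        exact I.add_mem ha (I.mul_mem_left _ hb) }
  change g ∈ H
  rw [← Finset.univ_sum_single g]
  refine H.sum_mem fun j _ => ?_
  have : Pi.single j (g j) = (g j).val • (Pi.single j 1 : κ → ZMod q) := by
    rw [← Pi.single_smul]
    simp
  rw [this]
  exact H.nsmul_mem (Ideal.subset_span ⟨j, rfl⟩) _

/-- A product of more than `|κ| * (q - 1)` elements of the augmentation ideal vanishes. -/
theorem prod_one_sub_single_eq_zero {p : ℕ} [Fact p.Prime] [CharP R p] {k : ℕ} {ι : Type}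
    (s : Finset ι) (g : ι → κ → ZMod (p ^ k)) (hs : Fintype.card κ * (p ^ k - 1) < s.card) :
    ∏ i ∈ s, (1 - single (g i) (1 : R)) = 0 := by
  classical
  have : CharP (AddMonoidAlgebra R (κ → ZMod (p ^ k))) p :=
    charP_of_injective_algebraMap (R := R) AddMonoidAlgebra.single_right_injective p
  have hnil : ∀ j : κ,
      (1 - single (Pi.single j 1) 1 : AddMonoidAlgebra R (κ → ZMod (p ^ k))) ^ p ^ k = 0 := by
    intro j
    rw [sub_pow_char_pow, single_pow, ← Pi.single_smul]
    simp [← one_def]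
  choose a ha using fun i =>
    (Ideal.mem_span_range_iff_exists_fun).mp (one_sub_single_mem_span (R := R) (p ^ k) (g i))
  simp_rw [← ha]
  rw [Finset.prod_sum]
  refine Finset.sum_eq_zero fun φ _ => ?_
  rw [Finset.prod_mul_distrib]
  obtain ⟨j, -, hj⟩ := Finset.exists_lt_card_fiber_of_mul_lt_card_of_maps_to (s := s.attach)
    (t := (Finset.univ : Finset κ)) (f := fun i => φ i.1 i.2) (n := p ^ k - 1)
    (fun _ _ => Finset.mem_univ _) (by simpa using hs)
  refine mul_eq_zero_of_right _ ?_
  rw [← Finset.prod_filter_mul_prod_filter_not s.attach (fun i => φ i.1 i.2 = j)]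
  refine mul_eq_zero_of_left ?_ _
  rw [Finset.prod_congr rfl (g := fun _ => (1 - single (Pi.single j 1) 1 :
    AddMonoidAlgebra R (κ → ZMod (p ^ k)))), Finset.prod_const]
  · exact pow_eq_zero_of_le (by omega) (hnil j)
  · intro i hi
    rw [(Finset.mem_filter.mp hi).2]

end AddMonoidAlgebra

namespace HasShortZeroSum

variable {κ : Type} [Fintype κ]

/-- Olson's theorem on the Davenport constant, for homocyclic `p`-groups. -/
theorem of_prime_pow {p : ℕ} (hp : p.Prime) (k : ℕ) :
    HasShortZeroSum κ (p ^ k) (Fintype.card κ * (p ^ k - 1) + 1)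
      (Fintype.card κ * (p ^ k - 1)) := by
  classical
  intro ι s' f hs'
  obtain ⟨s, hss, hs⟩ := Finset.exists_subset_card_eq (Nat.succ_le_of_lt hs')
  have : Fact p.Prime := ⟨hp⟩
  let g : ι → κ → ZMod (p ^ k) := fun i j => (f i j : ZMod (p ^ k))
  have hzero := AddMonoidAlgebra.prod_one_sub_single_eq_zero (R := ZMod p) (p := p) s g (by omega)
  by_contra! hno
  have hsum : ∀ t ⊆ s, t.Nonempty → ∑ i ∈ t, g i ≠ 0 := by
    intro t ht htn h0
    obtain ⟨j, hj⟩ := hno t (ht.trans hss) htn ((Finset.card_le_card ht).trans hs.le)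
    refine hj ?_
    rw [← ZMod.intCast_zmod_eq_zero_iff_dvd, Int.cast_sum]
    simpa [g] using congrFun h0 j
  have hterm : ∀ t : Finset ι, ∏ i ∈ t, -AddMonoidAlgebra.single (g i) (1 : ZMod p) =
      AddMonoidAlgebra.single (∑ i ∈ t, g i) ((-1) ^ t.card) := by
    intro t
    induction t using Finset.induction_on with
    | empty => simp [AddMonoidAlgebra.one_def]
    | insert i t hi ih =>
      rw [Finset.prod_insert hi, ih, Finset.sum_insert hi, Finset.card_insert_of_notMem hi,
        ← AddMonoidAlgebra.single_neg, AddMonoidAlgebra.single_mul_single, pow_succ']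
  simp_rw [sub_eq_add_neg] at hzero
  rw [Finset.prod_one_add] at hzero
  simp_rw [hterm] at hzero
  have hcoeff := congrArg (fun x : AddMonoidAlgebra (ZMod p) (κ → ZMod (p ^ k)) => x.coeff 0) hzero
  simp only [AddMonoidAlgebra.coeff_sum, Finsupp.finsetSum_apply, AddMonoidAlgebra.coeff_single,
    AddMonoidAlgebra.coeff_zero, Finsupp.coe_zero, Pi.zero_apply] at hcoeff
  rw [Finset.sum_eq_single ∅] at hcoeff
  · simp at hcoeff
  · intro t hts htn
    rw [Finsupp.single_apply,
      if_neg (hsum t (Finset.mem_powerset.mp hts) (Finset.nonempty_iff_ne_empty.mpr htn))]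
  · simp

theorem of_card_primeFactors (hκ : 0 < Fintype.card κ) {n : ℕ} (hn : n ≠ 0) :
    HasShortZeroSum κ n (Fintype.card κ ^ n.primeFactors.card * (n - 1) + 1)
      (Fintype.card κ ^ n.primeFactors.card * (n - 1)) := by
  induction n using Nat.recOnPosPrimePosCoprime with
  | zero => exact absurd rfl hn
  | one => simpa using one κ
  | prime_pow p k hp hk =>
    simpa [Nat.primeFactors_prime_pow hk.ne' hp] using of_prime_pow (κ := κ) hp k
  | coprime a b ha hb hab iha ihb =>
    have h := (iha (by omega)).mul (ihb (by omega))
    rw [Nat.Coprime.primeFactors_mul hab,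
      Finset.card_union_of_disjoint (Nat.Coprime.disjoint_primeFactors hab), pow_add]
    obtain ⟨a, rfl⟩ := Nat.exists_eq_succ_of_ne_zero (show a ≠ 0 by omega)
    obtain ⟨b, rfl⟩ := Nat.exists_eq_succ_of_ne_zero (show b ≠ 0 by omega)
    have : (a + 1) * (b + 1) - 1 = a * b + a + b := by
      rw [mul_add_one, add_one_mul]; omega
    simp only [Nat.succ_eq_add_one, Nat.add_sub_cancel, this] at h ⊢
    have hA := Nat.one_le_pow (a + 1).primeFactors.card _ hκ
    have hB := Nat.one_le_pow (b + 1).primeFactors.card _ hκ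
    set A := Fintype.card κ ^ (a + 1).primeFactors.card
    set B := Fintype.card κ ^ (b + 1).primeFactors.card
    have hAB : A ≤ A * B := Nat.le_mul_of_pos_right _ hB
    have hBA : B ≤ A * B := Nat.le_mul_of_pos_left _ hA
    refine h.mono ?_ ?_
    · nlinarith [Nat.mul_le_mul_right a hAB, Nat.mul_le_mul_right b hBA]
    · nlinarith [Nat.mul_le_mul_right a hAB, Nat.mul_le_mul_right b hBA]

end HasShortZeroSum

theorem Nat.exists_mul_eq_primeFactors_separated (k : ℕ) (n : ℕ) (hn : n ≠ 0)
    (hk : k ≤ n.primeFactors.card) :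
    ∃ b a, b * a = n ∧ a.primeFactors.card = k ∧
      ∀ p ∈ b.primeFactors, ∀ r ∈ a.primeFactors, p ≤ r := by
  induction n using Nat.strong_induction_on with
  | _ n ih =>
    rcases hk.eq_or_lt with h | h
    · exact ⟨1, n, one_mul n, h.symm, by simp⟩
    have hn1 : n ≠ 1 := by rintro rfl; simp at h
    have hp := Nat.minFac_prime hn1
    have hfac := Nat.ordProj_mul_ordCompl_eq_self n n.minFac
    have hpf : (n / n.minFac ^ n.factorization n.minFac).primeFactors =
        n.primeFactors.erase n.minFac := by
      rw [← Nat.support_factorization, Nat.factorization_ordCompl, Finsupp.support_erase,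
        Nat.support_factorization]
    set p := n.minFac
    set n' := n / p ^ n.factorization p with hn'
    have hmem : p ∈ n.primeFactors := Nat.mem_primeFactors.mpr ⟨hp, n.minFac_dvd, hn⟩
    have hn'0 : n' ≠ 0 := by rintro h0; rw [h0] at hfac; omega
    have hlt : n' < n := Nat.div_lt_self (Nat.pos_of_ne_zero hn)
      (Nat.one_lt_pow (hp.factorization_pos_of_dvd hn n.minFac_dvd).ne' hp.one_lt)
    obtain ⟨b, a, hba, hac, hsep⟩ := ih n' hlt hn'0 (by
      rw [hpf, Finset.card_erase_of_mem hmem]; omega)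
    have hb0 : b ≠ 0 := by rintro rfl; omega
    refine ⟨p ^ n.factorization p * b, a, by rw [mul_assoc, hba, hfac], hac, ?_⟩
    intro r hr r' hr'
    rw [Nat.primeFactors_mul (pow_ne_zero _ hp.ne_zero) hb0, Finset.mem_union] at hr
    rcases hr with hr | hr
    · have hrp := (Nat.prime_dvd_prime_iff_eq (Nat.prime_of_mem_primeFactors hr) hp).mp
        ((Nat.prime_of_mem_primeFactors hr).dvd_of_dvd_pow (Nat.dvd_of_mem_primeFactors hr))
      rw [hrp]
      refine Nat.minFac_le_of_dvd (Nat.prime_of_mem_primeFactors hr').two_le ?_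
      exact (Nat.dvd_of_mem_primeFactors hr').trans
        ((Dvd.intro_left b hba).trans (Dvd.intro_left _ hfac))
    · exact hsep r hr r' hr'

theorem HasShortZeroSum.of_ten_le_card_primeFactors {κ : Type} [Fintype κ]
    (hκ : Fintype.card κ = 3) {n : ℕ} (hn : n ≠ 0) (h : 10 ≤ n.primeFactors.card) :
    ∃ c, HasShortZeroSum κ n c (20369 * (n - 1)) := by
  obtain ⟨b, a, rfl, hac, hsep⟩ := Nat.exists_mul_eq_primeFactors_separated 9 n hn (by omega)
  have hb0 : b ≠ 0 := left_ne_zero_of_mul hn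
  have ha0 : a ≠ 0 := right_ne_zero_of_mul hn
  have ha1 : a ≠ 1 := by rintro rfl; simp at hac
  have hP : a.minFac ^ 9 ≤ a := by
    rw [← hac]
    refine (Finset.pow_card_le_prod a.primeFactors id _ fun p hp => ?_).trans
      (Nat.le_of_dvd (Nat.pos_of_ne_zero ha0) (Nat.prod_primeFactors_dvd a))
    exact Nat.minFac_le_of_dvd (Nat.prime_of_mem_primeFactors hp).two_le
      (Nat.dvd_of_mem_primeFactors hp)
  have hmin := Nat.minFac_prime ha1
  have hP3 : a.minFac ^ 3 ≤ a := (Nat.pow_le_pow_right hmin.pos (by norm_num)).trans hP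
  have ha512 : 2 ^ 9 ≤ a := (Nat.pow_le_pow_left hmin.two_le 9).trans hP
  have h₁ := of_primeFactors_le (κ := κ) hb0 fun p hp =>
    hsep p hp a.minFac (Nat.mem_primeFactors.mpr ⟨hmin, a.minFac_dvd, ha0⟩)
  have h₂ := of_card_primeFactors (κ := κ) (by omega) ha0
  rw [hκ, hac] at h₂
  rw [hκ] at h₁
  refine ⟨_, (h₁.mul h₂).mono le_rfl ?_⟩
  obtain ⟨b, rfl⟩ := Nat.exists_eq_succ_of_ne_zero hb0
  obtain ⟨a', ha'⟩ := Nat.exists_eq_succ_of_ne_zero ha0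
  have e1 : (b + 1) * a - 1 = b * a + a' := by
    rw [add_one_mul]; omega
  have e2 : a - 1 = a' := by omega
  simp only [Nat.succ_eq_add_one, Nat.add_sub_cancel, e1, e2]
  have := Nat.mul_le_mul_right b hP3
  have h1 : (b + 1) * (3 ^ 9 * a') ≤ 19683 * (b * a + a') := by
    have : b * a' ≤ b * a := by gcongr; omega
    nlinarith
  nlinarith

theorem exists_hasShortZeroSum {κ : Type} [Fintype κ] (hκ : Fintype.card κ = 3) {n : ℕ}
    (hn : n ≠ 0) :
    ∃ c, HasShortZeroSum κ n c (min 20369 (3 ^ n.primeFactors.card) * (n - 1)) := by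
  rcases le_or_gt 10 n.primeFactors.card with h | h
  · obtain ⟨c, hc⟩ := HasShortZeroSum.of_ten_le_card_primeFactors hκ hn h
    rw [min_eq_left ((show 20369 ≤ 3 ^ 10 by norm_num).trans
      (Nat.pow_le_pow_right (by norm_num) h))]
    exact ⟨c, hc⟩
  · rw [min_eq_right ((Nat.pow_le_pow_right (by norm_num) (Nat.le_of_lt_succ h)).trans
      (show 3 ^ 9 ≤ 20369 by norm_num))]
    have h := HasShortZeroSum.of_card_primeFactors (κ := κ) (by omega) hn
    rw [hκ] at h
    exact ⟨_, h⟩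

theorem Nat.exists_eq_pow_of_dvd_factorization {F : Finset ℕ} {n N : ℕ} (hN : N ≠ 0)
    (hF : N.primeFactors ⊆ F) (h : ∀ p ∈ F, n ∣ N.factorization p) : ∃ m, N = m ^ n := by
  choose! e he using h
  refine ⟨∏ p ∈ F, p ^ e p, ?_⟩
  conv_lhs => rw [← Nat.prod_factorization_pow_eq_self hN]
  rw [Finsupp.prod_of_support_subset _ (by simpa using hF) _ (by simp), ← Finset.prod_pow]
  exact Finset.prod_congr rfl fun p hp => by rw [he p hp, mul_comm, pow_mul]

theorem stmt_17 (F : Finset ℕ) (hF : ∀ p ∈ F, p.Prime) (hcard : F.card = 3)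
    (n : ℕ) (hn : 2 ≤ n) (S : Multiset ℕ)
    (hS : ∀ s ∈ S, 0 < s ∧ ∀ p : ℕ, p.Prime → p ∣ s → p ∈ F)
    (hlen : Multiset.card S = min 20369 (3 ^ n.primeFactors.card) * (n - 1) + 1) :
    ∃ T ≤ S, T ≠ 0 ∧ ∃ m : ℕ, T.prod = m ^ n := by
  obtain ⟨c, hc⟩ := exists_hasShortZeroSum (κ := F) (by simpa using hcard)
    (show n ≠ 0 by omega)
  induction S using Quotient.inductionOn with
  | _ l =>
  change ∃ T ≤ (l : Multiset ℕ), _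
  have hl : ∀ i : Fin l.length, 0 < l.get i ∧ ∀ p : ℕ, p.Prime → p ∣ l.get i → p ∈ F :=
    fun i => hS _ (by simp)
  obtain ⟨t, -, htn, -, htd⟩ := hc (Fin l.length) Finset.univ
    (fun i p => ((l.get i).factorization p : ℤ)) (by
      simp only [Finset.card_univ, Fintype.card_fin]
      simp only [Multiset.quot_mk_to_coe, Multiset.coe_card] at hlen
      omega)
  refine ⟨t.val.map l.get, ?_, ?_, ?_⟩
  · calc t.val.map l.get ≤ Finset.univ.val.map l.get :=
          Multiset.map_le_map (Finset.val_le_iff.mpr (Finset.subset_univ t))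
      _ = l := by simp
  · simpa using htn.ne_empty
  · change ∃ m, ∏ i ∈ t, l.get i = m ^ n
    have hne : ∀ i ∈ t, l.get i ≠ 0 := fun i _ => (hl i).1.ne'
    refine Nat.exists_eq_pow_of_dvd_factorization (F := F) (Finset.prod_ne_zero_iff.mpr hne) ?_ ?_
    · intro p hp
      have hpp := Nat.prime_of_mem_primeFactors hp
      obtain ⟨i, -, hi⟩ := (hpp.prime.dvd_finsetProd_iff _).mp (Nat.dvd_of_mem_primeFactors hp)
      exact (hl i).2 p hpp hi
    · intro p hp
      rw [Nat.factorization_prod hne, Finsupp.finsetSum_apply]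
      exact_mod_cast htd ⟨p, hp⟩
end
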